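/- arXiv:1801.06749 — 9 statements merged into one kernel-verified Lean document; each statement's English description precedes it below -/
import Mathlib

section
/- Let ν be a Borel probability measure on [0,∞) with ∫₀^∞ s dν(s) = 1 and g(z) = ∫₀^∞ e^{−zs} dν(s). Then for every z > 0 one has g(z) − e^{−z} = z² ∫₀^∞ e^{−zs} G(s) ds, where G(s) = ∫_{[0,s]} (s−τ) dν(τ) for 0 ≤ s ≤ 1 and G(s) = ∫_{[s,∞)} (τ−s) dν(τ) for s > 1; moreover G is nonnegative and continuous on [0,∞). In particular, the function z ↦ (g(z) − e^{−z})/z² is completely monotone on (0,∞). -/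
open MeasureTheory Real Set Filter

lemma integrableOn_mul_exp_neg_mul_Ioi {z : ℝ} (hz : 0 < z) :
    IntegrableOn (fun t : ℝ => t * exp (-z * t)) (Ioi 0) := by
  simpa using integrableOn_rpow_mul_exp_neg_mul_rpow (p := 1) (s := 1) (b := z)
    (by norm_num) one_pos hz

lemma integral_mul_exp_neg_mul_Ioi {z : ℝ} (hz : 0 < z) :
    ∫ t in Ioi (0 : ℝ), t * exp (-z * t) = 1 / z ^ 2 := by
  have h := integral_rpow_mul_exp_neg_mul_Ioi (a := 2) two_pos hz
  norm_num at h
  simpa [neg_mul, Real.Gamma_two] using h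

/-- The Laplace transform of a ramp `s ↦ (s - τ)⁺`. -/
lemma integral_exp_neg_mul_max_sub_Ioi {z τ : ℝ} (hz : 0 < z) (hτ : 0 ≤ τ) :
    ∫ s in Ioi (0 : ℝ), exp (-z * s) * max (s - τ) 0 = exp (-z * τ) / z ^ 2 := by
  have h1 : ∫ s in Ioi (0 : ℝ), exp (-z * s) * max (s - τ) 0
      = ∫ s in Ioi τ, exp (-z * s) * max (s - τ) 0 := by
    refine (setIntegral_eq_of_subset_of_forall_sdiff_eq_zero measurableSet_Ioi
      (Ioi_subset_Ioi hτ) fun s hs => ?_)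
    have : s ≤ τ := not_lt.mp hs.2
    simp [this]
  have h2 := (measurePreserving_add_right (volume : Measure ℝ) τ).setIntegral_preimage_emb
    (measurableEmbedding_addRight τ) (fun s => exp (-z * s) * max (s - τ) 0) (Ioi τ)
  have h3 : (fun x => x + τ) ⁻¹' Ioi τ = Ioi (0 : ℝ) := by ext; simp
  rw [h1, ← h2, h3, div_eq_mul_one_div, ← integral_mul_exp_neg_mul_Ioi hz, ← integral_const_mul]
  refine setIntegral_congr_fun measurableSet_Ioi fun s hs => ?_
  have hs' : 0 ≤ s := le_of_lt hs
  simp only [add_sub_cancel_right, max_eq_left hs', mul_add, exp_add]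
  ring

lemma integrable_max_sub {ν : Measure ℝ} [IsFiniteMeasure ν]
    (hint : Integrable (fun s => s) ν) (s : ℝ) :
    Integrable (fun τ => max (s - τ) 0) ν :=
  ((integrable_const s).sub hint).pos_part

lemma integrable_prod_exp_neg_mul_max_sub {ν : Measure ℝ} [IsFiniteMeasure ν]
    (hint : Integrable (fun s => s) ν) {z : ℝ} (hz : 0 < z) :
    Integrable (fun p : ℝ × ℝ => exp (-z * p.1) * max (p.1 - p.2) 0)
      ((volume.restrict (Ioi 0)).prod ν) := by
  have h1 : Integrable (fun p : ℝ × ℝ => (p.1 * exp (-z * p.1)) * 1)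
      ((volume.restrict (Ioi 0)).prod ν) :=
    Integrable.mul_prod (integrableOn_mul_exp_neg_mul_Ioi hz) (integrable_const (1 : ℝ))
  have h2 : Integrable (fun p : ℝ × ℝ => exp (-z * p.1) * p.2)
      ((volume.restrict (Ioi 0)).prod ν) :=
    Integrable.mul_prod (integrableOn_exp_mul_Ioi (neg_lt_zero.mpr hz) 0) hint
  refine (h1.norm.add h2.norm).mono' (by fun_prop) (ae_of_all _ fun p => ?_)
  have h3 : |max (p.1 - p.2) 0| ≤ |p.1| + |p.2| := by
    rw [abs_of_nonneg (le_max_right _ _)]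
    exact max_le ((le_abs_self _).trans (abs_sub _ _)) (by positivity)
  simp only [norm_eq_abs, abs_mul, abs_exp, Pi.add_apply, mul_one]
  nlinarith [exp_pos (-z * p.1)]

lemma integrableOn_exp_neg_mul_integral_max_sub {ν : Measure ℝ} [IsFiniteMeasure ν]
    (hint : Integrable (fun s => s) ν) {z : ℝ} (hz : 0 < z) :
    IntegrableOn (fun s => exp (-z * s) * ∫ τ, max (s - τ) 0 ∂ν) (Ioi 0) := by
  simpa only [integral_const_mul] using!
    (integrable_prod_exp_neg_mul_max_sub hint hz).integral_prod_left

lemma integral_exp_neg_mul_integral_max_sub {ν : Measure ℝ} [IsFiniteMeasure ν]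
    (hsupp : ν (Iio 0) = 0) (hint : Integrable (fun s => s) ν) {z : ℝ} (hz : 0 < z) :
    ∫ s in Ioi (0 : ℝ), exp (-z * s) * ∫ τ, max (s - τ) 0 ∂ν
      = (∫ τ, exp (-z * τ) ∂ν) / z ^ 2 := by
  have hae : ∀ᵐ τ ∂ν, 0 ≤ τ := by
    rw [ae_iff]; simpa [Iio_def] using hsupp
  simp only [← integral_const_mul]
  rw [integral_integral_swap (integrable_prod_exp_neg_mul_max_sub hint hz), ← integral_div]
  refine integral_congr_ae ?_
  filter_upwards [hae] with τ hτ using integral_exp_neg_mul_max_sub_Ioi hz hτ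

lemma continuous_integral_max_sub {ν : Measure ℝ} [IsProbabilityMeasure ν]
    (hint : Integrable (fun s => s) ν) : Continuous (fun s => ∫ τ, max (s - τ) 0 ∂ν) := by
  refine (LipschitzWith.of_dist_le_mul (K := 1) fun s t => ?_).continuous
  rw [dist_eq_norm, ← integral_sub (integrable_max_sub hint s) (integrable_max_sub hint t)]
  refine (norm_integral_le_of_norm_le_const (C := dist s t) (ae_of_all _ fun τ => ?_)).trans
    (by simp)
  have h := abs_max_sub_max_le_abs (s - τ) (t - τ) 0
  simpa [Real.dist_eq] using h

/-- The Laplace transform of a nonnegative continuous density is completely monotone. -/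
lemma iteratedDeriv_laplace_alternating {H : ℝ → ℝ} (hH : Continuous H)
    (hnonneg : ∀ s, 0 ≤ H s)
    (hintH : ∀ z : ℝ, 0 < z → IntegrableOn (fun s => exp (-z * s) * H s) (Ioi 0))
    {F : ℝ → ℝ} (hF : ∀ z : ℝ, 0 < z → F z = ∫ s in Ioi (0 : ℝ), exp (-z * s) * H s)
    (n : ℕ) {z : ℝ} (hz : 0 < z) : 0 ≤ (-1 : ℝ) ^ n * iteratedDeriv n F z := by
  set μ : Measure ℝ := (volume.restrict (Ioi 0)).withDensity fun s => ENNReal.ofReal (H s)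
    with hμ
  have hmeas : Measurable fun s => ENNReal.ofReal (H s) := hH.measurable.ennreal_ofReal
  have hfin : ∀ᵐ s ∂(volume.restrict (Ioi (0 : ℝ))), ENNReal.ofReal (H s) < ⊤ :=
    ae_of_all _ fun s => ENNReal.ofReal_lt_top
  have hmem : Ioi (0 : ℝ) ⊆ ProbabilityTheory.integrableExpSet (fun s : ℝ => -s) μ := by
    intro w hw
    refine (integrable_withDensity_iff_integrable_smul' hmeas hfin).mpr ?_
    refine (hintH w hw).congr (ae_of_all _ fun s => ?_)
    simp [ENNReal.toReal_ofReal (hnonneg s), mul_comm]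
  have heq : F =ᶠ[nhds z] ProbabilityTheory.mgf (fun s : ℝ => -s) μ := by
    filter_upwards [Ioi_mem_nhds hz] with w hw
    rw [hF w hw, ProbabilityTheory.mgf, hμ,
      integral_withDensity_eq_integral_toReal_smul hmeas hfin]
    refine integral_congr_ae (ae_of_all _ fun s => ?_)
    simp [ENNReal.toReal_ofReal (hnonneg s), mul_comm]
  rw [heq.iteratedDeriv_eq, ProbabilityTheory.iteratedDeriv_mgf
    (interior_maximal hmem isOpen_Ioi hz), ← integral_const_mul]
  refine integral_nonneg_of_ae ?_
  have hpos : ∀ᵐ s ∂μ, (0 : ℝ) < s :=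
    (withDensity_absolutelyContinuous _ _).ae_le (ae_restrict_mem measurableSet_Ioi)
  filter_upwards [hpos] with s hs
  rw [← mul_assoc, ← mul_pow]
  simp only [neg_mul_neg, one_mul, Pi.zero_apply]
  positivity

lemma integral_Icc_sub_eq {ν : Measure ℝ} (hsupp : ν (Iio 0) = 0) (s : ℝ) :
    ∫ τ in Icc 0 s, (s - τ) ∂ν = ∫ τ, max (s - τ) 0 ∂ν := by
  have hae : ∀ᵐ τ ∂ν, 0 ≤ τ := by
    rw [ae_iff]; simpa [Iio_def] using hsupp
  rw [← integral_indicator measurableSet_Icc]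
  refine integral_congr_ae ?_
  filter_upwards [hae] with τ hτ
  by_cases h : τ ≤ s
  · simp [indicator, hτ, h]
  · simp [indicator, h, (not_le.mp h).le]

lemma integral_Ici_sub_eq {ν : Measure ℝ} [IsProbabilityMeasure ν]
    (hint : Integrable (fun s => s) ν) (s : ℝ) :
    ∫ τ in Ici s, (τ - s) ∂ν = (∫ τ, max (s - τ) 0 ∂ν) - (s - ∫ τ, τ ∂ν) := by
  have h : ∫ τ, (s - τ) ∂ν = s - ∫ τ, τ ∂ν := by
    rw [integral_sub (integrable_const s) hint]; simp
  have hsub : Integrable (fun τ => s - τ) ν := (integrable_const s).sub hint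
  rw [← h, ← integral_sub (integrable_max_sub hint s) hsub,
    ← integral_indicator measurableSet_Ici]
  refine integral_congr_ae (ae_of_all _ fun τ => ?_)
  by_cases h : s ≤ τ
  · simp [indicator, h]
  · simp [indicator, h, (not_le.mp h).le]

theorem stmt_0
    (ν : Measure ℝ) [IsProbabilityMeasure ν]
    (hsupp : ν (Set.Iio 0) = 0)
    (hint : Integrable (fun s => s) ν)
    (hmean : (∫ s, s ∂ν) = 1)
    (g : ℝ → ℝ) (hg : ∀ z : ℝ, g z = ∫ s, Real.exp (-z * s) ∂ν)
    (G : ℝ → ℝ)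
    (hG : ∀ s : ℝ, G s = if s ≤ 1 then ∫ τ in Set.Icc 0 s, (s - τ) ∂ν
        else ∫ τ in Set.Ici s, (τ - s) ∂ν) :
    (∀ z : ℝ, 0 < z →
        g z - Real.exp (-z) = z ^ 2 * ∫ s in Set.Ioi (0:ℝ), Real.exp (-z * s) * G s) ∧
    (∀ s : ℝ, 0 ≤ s → 0 ≤ G s) ∧
    ContinuousOn G (Set.Ici 0) ∧
    (∀ (n : ℕ) (z : ℝ), 0 < z →
        0 ≤ (-1 : ℝ) ^ n *
          iteratedDeriv n (fun w => (g w - Real.exp (-w)) / w ^ 2) z) := by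
  have hGeq : G = fun s => (∫ τ, max (s - τ) 0 ∂ν) - max (s - 1) 0 := by
    funext s
    rw [hG]
    split_ifs with h
    · simp [integral_Icc_sub_eq hsupp, h]
    · rw [integral_Ici_sub_eq hint, hmean, max_eq_left (by linarith : 0 ≤ s - 1)]
  have hcont : Continuous G := by
    rw [hGeq]
    exact (continuous_integral_max_sub hint).sub (by fun_prop)
  have hnonneg : ∀ s, 0 ≤ G s := fun s => by
    rw [hG]
    split_ifs
    · exact setIntegral_nonneg measurableSet_Icc fun τ hτ => sub_nonneg.mpr hτ.2
    · exact setIntegral_nonneg measurableSet_Ici fun τ hτ => sub_nonneg.mpr hτ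
  have hintdirac : ∀ z : ℝ, 0 < z →
      IntegrableOn (fun s => exp (-z * s) * max (s - 1) 0) (Ioi 0) := fun z hz =>
    .of_integral_ne_zero (by
      rw [integral_exp_neg_mul_max_sub_Ioi hz zero_le_one]; positivity)
  have hintG : ∀ z : ℝ, 0 < z → IntegrableOn (fun s => exp (-z * s) * G s) (Ioi 0) :=
    fun z hz => by
      simp only [hGeq, mul_sub]
      exact (integrableOn_exp_neg_mul_integral_max_sub hint hz).sub (hintdirac z hz)
  have hlap : ∀ z : ℝ, 0 < z →
      ∫ s in Ioi (0 : ℝ), exp (-z * s) * G s = (g z - exp (-z)) / z ^ 2 := fun z hz => by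
    simp only [hGeq, mul_sub]
    rw [integral_sub (integrableOn_exp_neg_mul_integral_max_sub hint hz) (hintdirac z hz),
      integral_exp_neg_mul_integral_max_sub hsupp hint hz,
      integral_exp_neg_mul_max_sub_Ioi hz zero_le_one, hg, mul_one, sub_div]
  refine ⟨fun z hz => ?_, fun s _ => hnonneg s, hcont.continuousOn, fun n z hz => ?_⟩
  · rw [hlap z hz]
    field_simp
  · exact iteratedDeriv_laplace_alternating hcont hnonneg hintG
      (fun w hw => (hlap w hw).symm) n hz
end

section
/- Let ν be a Borel probability measure on [0,∞) with ∫₀^∞ s dν(s) = 1 and g(z) = ∫₀^∞ e^{−zs} dν(s). Then for every t > 0 and every positive integer n: 0 ≤ g(t/n)ⁿ − e^{−t} ≤ t·(1 + g'(t/n)), where g'(t/n) = −∫₀^∞ s e^{−(t/n)s} dν(s). In particular g(t/n)ⁿ → e^{−t} as n → ∞, uniformly in t from compact subsets of [0,∞). -/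
open MeasureTheory Real Set Filter

lemma pow_sub_pow_le_mul_sub {a b : ℝ} (hb : 0 ≤ b) (hab : b ≤ a) (ha : a ≤ 1) (n : ℕ) :
    a ^ n - b ^ n ≤ n * (a - b) := by
  induction n with
  | zero => simp
  | succ k ih =>
    have h1 : a * (a ^ k - b ^ k) ≤ 1 * (a ^ k - b ^ k) :=
      mul_le_mul_of_nonneg_right ha (sub_nonneg.2 (pow_le_pow_left₀ hb hab k))
    have h2 : b ^ k * (a - b) ≤ 1 * (a - b) :=
      mul_le_mul_of_nonneg_right (pow_le_one₀ hb (hab.trans ha)) (sub_nonneg.2 hab)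
    have h3 : a ^ (k + 1) - b ^ (k + 1) = a * (a ^ k - b ^ k) + b ^ k * (a - b) := by ring
    push_cast
    linarith

lemma exp_neg_mul_le_one {z s : ℝ} (hz : 0 ≤ z) (hs : 0 ≤ s) : exp (-z * s) ≤ 1 :=
  exp_le_one_iff.2 (by nlinarith [mul_nonneg hz hs])

lemma exp_neg_add_mul_exp_neg_le_one (u : ℝ) : exp (-u) + u * exp (-u) ≤ 1 := by
  have h : (u + 1) * exp (-u) ≤ exp u * exp (-u) :=
    mul_le_mul_of_nonneg_right (add_one_le_exp u) (exp_pos _).le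
  rw [← exp_add, add_neg_cancel, exp_zero] at h
  linarith

section Laplace

variable {ν : Measure ℝ}

lemma integrable_exp_neg_mul [IsFiniteMeasure ν] (hν : ∀ᵐ s ∂ν, 0 ≤ s) {z : ℝ} (hz : 0 ≤ z) :
    Integrable (fun s => exp (-z * s)) ν := by
  refine Integrable.of_bound (C := 1) (by fun_prop) ?_
  filter_upwards [hν] with s hs
  rw [norm_of_nonneg (exp_pos _).le]
  exact exp_neg_mul_le_one hz hs

lemma integrable_mul_exp_neg_mul (hν : ∀ᵐ s ∂ν, 0 ≤ s) (hint : Integrable (fun s => s) ν)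
    {z : ℝ} (hz : 0 ≤ z) : Integrable (fun s => s * exp (-z * s)) ν := by
  refine hint.mono' (by fun_prop) ?_
  filter_upwards [hν] with s hs
  rw [norm_of_nonneg (mul_nonneg hs (exp_pos _).le)]
  exact mul_le_of_le_one_right hs (exp_neg_mul_le_one hz hs)

lemma integral_exp_neg_mul_le_one [IsProbabilityMeasure ν] (hν : ∀ᵐ s ∂ν, 0 ≤ s)
    {z : ℝ} (hz : 0 ≤ z) : ∫ s, exp (-z * s) ∂ν ≤ 1 := by
  have h : ∫ s, exp (-z * s) ∂ν ≤ ∫ _, (1 : ℝ) ∂ν := by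
    refine integral_mono_ae (integrable_exp_neg_mul hν hz) (integrable_const 1) ?_
    filter_upwards [hν] with s hs
    exact exp_neg_mul_le_one hz hs
  simpa using h

lemma exp_neg_le_integral_exp_neg_mul [IsProbabilityMeasure ν] (hν : ∀ᵐ s ∂ν, 0 ≤ s)
    (hint : Integrable (fun s => s) ν) (hmean : ∫ s, s ∂ν = 1) {z : ℝ} (hz : 0 ≤ z) :
    exp (-z) ≤ ∫ s, exp (-z * s) ∂ν := by
  have hI : Integrable (fun s => exp (-z) * (1 + z) - exp (-z) * z * s) ν :=
    (integrable_const _).sub (hint.const_mul _)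
  have h : ∫ s, (exp (-z) * (1 + z) - exp (-z) * z * s) ∂ν ≤ ∫ s, exp (-z * s) ∂ν := by
    refine integral_mono hI (integrable_exp_neg_mul hν hz) fun s => ?_
    have h1 := mul_le_mul_of_nonneg_left (add_one_le_exp (z - z * s)) (exp_pos (-z)).le
    rw [← exp_add, show -z + (z - z * s) = -z * s by ring] at h1
    dsimp only
    linarith
  rw [integral_sub (integrable_const _) (hint.const_mul _), integral_const_mul (_ * z), hmean,
    integral_const, probReal_univ, one_smul] at h
  linarith

lemma integral_exp_neg_mul_add_mul_integral_le_one [IsProbabilityMeasure ν]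
    (hν : ∀ᵐ s ∂ν, 0 ≤ s) (hint : Integrable (fun s => s) ν) {z : ℝ} (hz : 0 ≤ z) :
    ∫ s, exp (-z * s) ∂ν + z * ∫ s, s * exp (-z * s) ∂ν ≤ 1 := by
  have h1 := integrable_exp_neg_mul hν hz
  have h2 := (integrable_mul_exp_neg_mul hν hint hz).const_mul z
  rw [← integral_const_mul, ← integral_add h1 h2]
  have h : ∫ s, (exp (-z * s) + z * (s * exp (-z * s))) ∂ν ≤ ∫ _, (1 : ℝ) ∂ν := by
    refine integral_mono (h1.add h2) (integrable_const 1) fun s => ?_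
    have := exp_neg_add_mul_exp_neg_le_one (z * s)
    simpa only [neg_mul, mul_assoc] using this
  simpa using h

lemma integral_mul_exp_neg_mul_anti (hν : ∀ᵐ s ∂ν, 0 ≤ s) (hint : Integrable (fun s => s) ν)
    {z w : ℝ} (hz : 0 ≤ z) (hzw : z ≤ w) :
    ∫ s, s * exp (-w * s) ∂ν ≤ ∫ s, s * exp (-z * s) ∂ν := by
  refine integral_mono_ae (integrable_mul_exp_neg_mul hν hint (hz.trans hzw))
    (integrable_mul_exp_neg_mul hν hint hz) ?_
  filter_upwards [hν] with s hs
  have : -w * s ≤ -z * s := mul_le_mul_of_nonneg_right (neg_le_neg hzw) hs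
  gcongr

lemma tendsto_integral_mul_exp_neg_div (hν : ∀ᵐ s ∂ν, 0 ≤ s) (hint : Integrable (fun s => s) ν)
    {M : ℝ} (hM : 0 ≤ M) :
    Tendsto (fun n : ℕ => ∫ s, s * exp (-(M / n) * s) ∂ν) atTop (nhds (∫ s, s ∂ν)) := by
  refine tendsto_integral_of_dominated_convergence (fun s => s)
    (fun n => by fun_prop) hint (fun n => ?_) (.of_forall fun s => ?_)
  · filter_upwards [hν] with s hs
    rw [norm_of_nonneg (mul_nonneg hs (exp_pos _).le)]
    exact mul_le_of_le_one_right hs (exp_neg_mul_le_one (by positivity) hs)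
  · have hcont : Continuous fun z : ℝ => s * exp (-z * s) := by fun_prop
    simpa [Function.comp_def] using (hcont.tendsto 0).comp (tendsto_const_div_atTop_nhds_zero_nat M)

end Laplace

theorem stmt_3
    (ν : Measure ℝ) [IsProbabilityMeasure ν]
    (hsupp : ν (Set.Iio 0) = 0)
    (hint : Integrable (fun s => s) ν)
    (hmean : (∫ s, s ∂ν) = 1)
    (g : ℝ → ℝ) (hg : ∀ z : ℝ, g z = ∫ s, Real.exp (-z * s) ∂ν)
    (g' : ℝ → ℝ) (hg' : ∀ z : ℝ, g' z = -∫ s, s * Real.exp (-z * s) ∂ν) :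
    (∀ t : ℝ, 0 < t → ∀ n : ℕ, 0 < n →
       0 ≤ g (t / n) ^ n - Real.exp (-t) ∧
       g (t / n) ^ n - Real.exp (-t) ≤ t * (1 + g' (t / n))) ∧
    (∀ K : Set ℝ, IsCompact K → K ⊆ Set.Ici 0 →
       TendstoUniformlyOn (fun (n : ℕ) (t : ℝ) => g (t / n) ^ n)
         (fun t => Real.exp (-t)) Filter.atTop K) := by
  have hν : ∀ᵐ s ∂ν, 0 ≤ s := by
    rw [ae_iff]
    simpa only [not_le, Iio_def] using hsupp
  have key : ∀ t : ℝ, 0 ≤ t → ∀ n : ℕ, 0 < n →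
      0 ≤ g (t / n) ^ n - exp (-t) ∧
      g (t / n) ^ n - exp (-t) ≤ t * (1 + g' (t / n)) := by
    intro t ht n hn
    have hn' : (0 : ℝ) < n := Nat.cast_pos.2 hn
    obtain ⟨z, hz⟩ : ∃ z, z = t / n := ⟨_, rfl⟩
    have htz : t = n * z := by rw [hz]; field_simp
    have hz0 : 0 ≤ z := hz ▸ by positivity
    have hexp : exp (-t) = exp (-z) ^ n := by
      rw [← exp_nat_mul, htz, mul_neg]
    have hlow := exp_neg_le_integral_exp_neg_mul hν hint hmean hz0
    have hup := integral_exp_neg_mul_le_one hν hz0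
    have hder := integral_exp_neg_mul_add_mul_integral_le_one hν hint hz0
    have hez := add_one_le_exp (-z)
    rw [← hz, hexp, hg, hg']
    refine ⟨sub_nonneg.2 (pow_le_pow_left₀ (exp_pos _).le hlow n),
      (pow_sub_pow_le_mul_sub (exp_pos _).le hlow hup n).trans ?_⟩
    rw [htz, mul_assoc]
    exact mul_le_mul_of_nonneg_left (by linarith) hn'.le
  refine ⟨fun t ht => key t ht.le, fun K hK hK0 => ?_⟩
  obtain ⟨B, hB⟩ := hK.bddAbove
  obtain ⟨M, hM0, hM⟩ : ∃ M : ℝ, 0 ≤ M ∧ ∀ t ∈ K, t ≤ M :=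
    ⟨max B 0, le_max_right _ _, fun t ht => (hB ht).trans (le_max_left _ _)⟩
  have hlim : Tendsto (fun n : ℕ => M * (1 + g' (M / n))) atTop (nhds 0) := by
    have h := ((tendsto_integral_mul_exp_neg_div hν hint hM0).const_sub 1).const_mul M
    simp only [hmean, sub_self, mul_zero] at h
    simpa only [hg', ← sub_eq_add_neg] using h
  rw [Metric.tendstoUniformlyOn_iff]
  intro ε hε
  filter_upwards [hlim.eventually_lt_const hε, eventually_gt_atTop 0] with n hnε hn t ht
  have ht0 : 0 ≤ t := hK0 ht
  obtain ⟨h1, h2⟩ := key t ht0 n hn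
  have hzM : t / n ≤ M / n := div_le_div_of_nonneg_right (hM t ht) (Nat.cast_nonneg n)
  have hmono : g' (t / n) ≤ g' (M / n) := by
    rw [hg', hg']
    exact neg_le_neg (integral_mul_exp_neg_mul_anti hν hint (by positivity) hzM)
  have hnonneg : 0 ≤ 1 + g' (M / n) := by
    have h := integral_mul_exp_neg_mul_anti hν hint le_rfl (show 0 ≤ M / n by positivity)
    simp only [neg_zero, zero_mul, exp_zero, mul_one, hmean] at h
    rw [hg']
    linarith
  rw [dist_comm, Real.dist_eq, abs_of_nonneg h1]
  calc g (t / n) ^ n - exp (-t) ≤ t * (1 + g' (t / n)) := h2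
    _ ≤ t * (1 + g' (M / n)) := by gcongr
    _ ≤ M * (1 + g' (M / n)) := mul_le_mul_of_nonneg_right (hM t ht) hnonneg
    _ < ε := hnε
end

section
/- Let ν be a Borel probability measure on [0,∞) with ∫₀^∞ s dν(s) = 1, and let g(z) = ∫₀^∞ e^{−zs} dν(s), g'(z) = −∫₀^∞ s e^{−zs} dν(s). Then for every z > 0: (g(z) + g'(z))/z = ∫₀^∞ e^{−zs} G₀(s) ds, where G₀(s) = ∫_{[0,s]} (1−τ) dν(τ) for 0 ≤ s ≤ 1 and G₀(s) = ∫_{[s,∞)} (τ−1) dν(τ) for s > 1; G₀ is nonnegative, so z ↦ (g(z)+g'(z))/z is completely monotone, and in particular g(z) + g'(z) ≥ 0 for all z > 0. If moreover g''(0) := ∫₀^∞ s² dν(s) < ∞, then ∫₀^∞ G₀(s) ds = g''(0) − 1, and consequently g(z) + g'(z) ≤ (g''(0) − 1) z for all z ≥ 0. -/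
open MeasureTheory Real Set Filter

/-- The kernel `|τ - 1|` supported on those `s` lying between `τ` and `1`. -/
noncomputable def stepKernel (s τ : ℝ) : ℝ :=
  if s ≤ 1 then (if τ ≤ s then 1 - τ else 0) else (if s ≤ τ then τ - 1 else 0)

theorem stepKernel_nonneg (s τ : ℝ) : 0 ≤ stepKernel s τ := by
  unfold stepKernel
  split_ifs <;> linarith

theorem measurable_stepKernel : Measurable fun p : ℝ × ℝ => stepKernel p.1 p.2 := by
  unfold stepKernel
  refine Measurable.ite (measurableSet_le measurable_fst measurable_const) ?_ ?_
  · exact Measurable.ite (measurableSet_le measurable_snd measurable_fst)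
      (measurable_const.sub measurable_snd) measurable_const
  · exact Measurable.ite (measurableSet_le measurable_fst measurable_snd)
      (measurable_snd.sub measurable_const) measurable_const

theorem integral_stepKernel_right {ν : Measure ℝ} (hν : ∀ᵐ τ ∂ν, 0 ≤ τ) (s : ℝ) :
    ∫ τ, stepKernel s τ ∂ν = if s ≤ 1 then ∫ τ in Icc 0 s, (1 - τ) ∂ν
      else ∫ τ in Ici s, (τ - 1) ∂ν := by
  split_ifs with h
  · rw [← integral_indicator measurableSet_Icc]
    refine integral_congr_ae ?_
    filter_upwards [hν] with τ hτ
    simp [stepKernel, h, indicator, hτ]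
  · rw [← integral_indicator measurableSet_Ici]
    refine integral_congr_ae (ae_of_all _ fun τ => ?_)
    simp [stepKernel, h, indicator]

theorem stepKernel_ae_eq (τ : ℝ) (w : ℝ → ℝ) :
    (fun s => w s * stepKernel s τ) =ᵐ[volume.restrict (Ioi 0)]
      (uIoc τ 1).indicator fun s => w s * |τ - 1| := by
  refine ae_restrict_of_ae ?_
  filter_upwards [compl_mem_ae_iff.mpr (measure_singleton τ)] with s hs
  have hs : s ≠ τ := hs
  rcases le_total τ 1 with h | h
  · rw [uIoc_of_le h, abs_of_nonpos (by linarith)]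
    by_cases h1 : s ≤ 1
    · by_cases h2 : τ ≤ s
      · simp [stepKernel, h1, h2, lt_of_le_of_ne h2 hs.symm]
      · rw [indicator_of_notMem fun h' => h2 h'.1.le]
        simp [stepKernel, h1, h2]
    · have h2 : ¬ s ≤ τ := fun h' => h1 (h'.trans h)
      simp [stepKernel, h1, h2]
  · rw [uIoc_of_ge h, abs_of_nonneg (by linarith)]
    by_cases h1 : s ≤ 1
    · by_cases h2 : τ ≤ s
      · exact absurd (le_antisymm (h1.trans h) h2) hs
      · simp [stepKernel, h1, h2]
    · by_cases h2 : s ≤ τ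
      · simp [stepKernel, h1, h2, not_le.mp h1]
      · simp [stepKernel, h1, h2]

theorem uIoc_subset_Ioi {τ : ℝ} (hτ : 0 ≤ τ) : uIoc τ 1 ⊆ Ioi 0 := fun _ hs =>
  lt_of_le_of_lt (le_min hτ zero_le_one) hs.1

theorem integrableOn_mul_stepKernel {τ : ℝ} {w : ℝ → ℝ} (hw : Continuous w) :
    IntegrableOn (fun s => w s * stepKernel s τ) (Ioi 0) := by
  have h : IntegrableOn (fun s => w s * |τ - 1|) (uIoc τ 1) := by
    rw [← intervalIntegrable_iff]
    exact (hw.mul continuous_const).intervalIntegrable _ _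
  exact ((h.integrable_indicator measurableSet_uIoc).restrict).congr (stepKernel_ae_eq τ w).symm

theorem setIntegral_mul_stepKernel {τ : ℝ} (hτ : 0 ≤ τ) (w : ℝ → ℝ) :
    ∫ s in Ioi 0, w s * stepKernel s τ = (τ - 1) * ∫ s in (1 : ℝ)..τ, w s := by
  rw [integral_congr_ae (stepKernel_ae_eq τ w), setIntegral_indicator measurableSet_uIoc,
    inter_eq_self_of_subset_right (uIoc_subset_Ioi hτ), integral_mul_const]
  rcases le_total τ 1 with h | h
  · rw [uIoc_of_le h, intervalIntegral.integral_of_ge h, abs_of_nonpos (by linarith)]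
    ring
  · rw [uIoc_of_ge h, intervalIntegral.integral_of_le h, abs_of_nonneg (by linarith)]
    ring

theorem integrable_and_integral_mul_integral_stepKernel {ν : Measure ℝ} [SFinite ν]
    (hν : ∀ᵐ τ ∂ν, 0 ≤ τ) {w : ℝ → ℝ} (hw : Continuous w) (hw0 : ∀ s, 0 ≤ w s)
    (hφ : Integrable (fun τ => (τ - 1) * ∫ s in (1 : ℝ)..τ, w s) ν) :
    IntegrableOn (fun s => w s * ∫ τ, stepKernel s τ ∂ν) (Ioi 0) ∧
      ∫ s in Ioi 0, w s * ∫ τ, stepKernel s τ ∂ν =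
        ∫ τ, (τ - 1) * (∫ s in (1 : ℝ)..τ, w s) ∂ν := by
  have hprod : Integrable (Function.uncurry fun s τ => w s * stepKernel s τ)
      ((volume.restrict (Ioi (0 : ℝ))).prod ν) := by
    have hm : Measurable (Function.uncurry fun s τ => w s * stepKernel s τ) :=
      (hw.measurable.comp measurable_fst).mul measurable_stepKernel
    refine (integrable_prod_iff' hm.aestronglyMeasurable).mpr
      ⟨ae_of_all _ fun τ => integrableOn_mul_stepKernel hw, hφ.congr ?_⟩
    filter_upwards [hν] with τ hτ
    rw [← setIntegral_mul_stepKernel hτ]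
    refine integral_congr_ae (ae_of_all _ fun s => ?_)
    exact (norm_of_nonneg (mul_nonneg (hw0 s) (stepKernel_nonneg s τ))).symm
  simp_rw [← integral_const_mul]
  refine ⟨hprod.integral_prod_left, ?_⟩
  rw [integral_integral_swap hprod]
  refine integral_congr_ae ?_
  filter_upwards [hν] with τ hτ
  exact setIntegral_mul_stepKernel hτ w

theorem intervalIntegral_exp_neg_mul {z : ℝ} (hz : z ≠ 0) (a b : ℝ) :
    ∫ s in a..b, exp (-z * s) = (exp (-z * a) - exp (-z * b)) / z := by
  rw [intervalIntegral.integral_comp_mul_left _ (neg_ne_zero.mpr hz), integral_exp, smul_eq_mul]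
  field_simp
  ring

theorem stmt_5
    (ν : Measure ℝ) [IsProbabilityMeasure ν]
    (hsupp : ν (Set.Iio 0) = 0)
    (hint : Integrable (fun s => s) ν)
    (hmean : (∫ s, s ∂ν) = 1)
    (g : ℝ → ℝ) (hg : ∀ z : ℝ, g z = ∫ s, Real.exp (-z * s) ∂ν)
    (g' : ℝ → ℝ) (hg' : ∀ z : ℝ, g' z = -∫ s, s * Real.exp (-z * s) ∂ν)
    (G0 : ℝ → ℝ)
    (hG0 : ∀ s : ℝ, G0 s = if s ≤ 1 then ∫ τ in Set.Icc 0 s, (1 - τ) ∂ν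
        else ∫ τ in Set.Ici s, (τ - 1) ∂ν) :
    (∀ z : ℝ, 0 < z →
        (g z + g' z) / z = ∫ s in Set.Ioi (0:ℝ), Real.exp (-z * s) * G0 s) ∧
    (∀ s : ℝ, 0 ≤ s → 0 ≤ G0 s) ∧
    (∀ z : ℝ, 0 < z → 0 ≤ g z + g' z) ∧
    (Integrable (fun s => s ^ 2) ν →
       (∫ s in Set.Ioi (0:ℝ), G0 s) = (∫ s, s ^ 2 ∂ν) - 1 ∧
       ∀ z : ℝ, 0 ≤ z → g z + g' z ≤ ((∫ s, s ^ 2 ∂ν) - 1) * z) := by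
  have hν : ∀ᵐ τ ∂ν, 0 ≤ τ := by
    rw [ae_iff]
    simp only [not_le]
    exact hsupp
  have hG (s : ℝ) : G0 s = ∫ τ, stepKernel s τ ∂ν := by
    rw [hG0, integral_stepKernel_right hν]
  have hG_nonneg (s : ℝ) : 0 ≤ G0 s := by
    rw [hG]
    exact integral_nonneg fun τ => stepKernel_nonneg s τ
  have hlaplace (z : ℝ) (hz : 0 < z) :
      IntegrableOn (fun s => exp (-z * s) * G0 s) (Ioi 0) ∧
        (g z + g' z) / z = ∫ s in Ioi (0 : ℝ), exp (-z * s) * G0 s := by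
    have hbound : ∀ᵐ τ ∂ν, ‖exp (-z * τ)‖ ≤ 1 := by
      filter_upwards [hν] with τ hτ
      rw [norm_of_nonneg (exp_pos _).le]
      exact exp_le_one_iff.mpr (by nlinarith)
    have hmeas : AEStronglyMeasurable (fun τ => exp (-z * τ)) ν :=
      Continuous.aestronglyMeasurable (by fun_prop)
    have hexp : Integrable (fun τ => exp (-z * τ)) ν := Integrable.of_bound hmeas 1 hbound
    have hmul : Integrable (fun τ => τ * exp (-z * τ)) ν := hint.mul_bdd hmeas hbound
    have hlin : Integrable (fun τ => exp (-z) * (τ - 1)) ν :=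
      (hint.sub (integrable_const 1)).const_mul _
    have hφ (τ : ℝ) : (τ - 1) * ∫ s in (1 : ℝ)..τ, exp (-z * s) =
        (exp (-z) * (τ - 1) - τ * exp (-z * τ) + exp (-z * τ)) / z := by
      rw [intervalIntegral_exp_neg_mul hz.ne', mul_one]
      ring
    have key := integrable_and_integral_mul_integral_stepKernel hν
      (w := fun s => exp (-z * s)) (by fun_prop) (fun s => (exp_pos _).le)
      (by simp_rw [hφ]; exact ((hlin.sub hmul).add hexp).div_const z)
    simp_rw [← hG, hφ] at key
    have hsub : Integrable (fun τ => exp (-z) * (τ - 1) - τ * exp (-z * τ)) ν := hlin.sub hmul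
    refine ⟨key.1, ?_⟩
    rw [key.2, integral_div, integral_add hsub hexp, integral_sub hlin hmul,
      integral_const_mul, integral_sub hint (integrable_const 1), hmean, hg, hg']
    simp only [integral_const, probReal_univ, smul_eq_mul]
    ring
  refine ⟨fun z hz => (hlaplace z hz).2, fun s _ => hG_nonneg s, fun z hz => ?_, fun hsq => ?_⟩
  · have h : 0 ≤ (g z + g' z) / z := by
      rw [(hlaplace z hz).2]
      exact integral_nonneg fun s => mul_nonneg (exp_pos _).le (hG_nonneg s)
    simpa [hz.ne'] using mul_nonneg h hz.le
  · have hφ (τ : ℝ) : (τ - 1) * ∫ _ in (1 : ℝ)..τ, (1 : ℝ) = τ ^ 2 - 2 * τ + 1 := by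
      rw [intervalIntegral.integral_const, smul_eq_mul]
      ring
    have hsub : Integrable (fun τ => τ ^ 2 - 2 * τ) ν := hsq.sub (hint.const_mul 2)
    have key := integrable_and_integral_mul_integral_stepKernel hν
      (w := fun _ => 1) continuous_const (fun _ => zero_le_one)
      (by simp_rw [hφ]; exact hsub.add (integrable_const 1))
    simp_rw [← hG, hφ, one_mul] at key
    have htotal : ∫ s in Ioi (0 : ℝ), G0 s = (∫ s, s ^ 2 ∂ν) - 1 := by
      rw [key.2, integral_add hsub (integrable_const 1), integral_sub hsq (hint.const_mul 2),
        integral_const_mul, hmean]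
      simp only [integral_const, probReal_univ, smul_eq_mul]
      ring
    refine ⟨htotal, fun z hz => ?_⟩
    rcases hz.eq_or_lt with rfl | hz
    · simp [hg, hg', hmean]
    · rw [← div_le_iff₀ hz, (hlaplace z hz).2, ← htotal]
      refine setIntegral_mono_on (hlaplace z hz).1 key.1 measurableSet_Ioi fun s hs => ?_
      have hs : 0 < s := hs
      exact mul_le_of_le_one_left (hG_nonneg s) (exp_le_one_iff.mpr (by nlinarith))
end

section
/- Let ν be a Borel probability measure on [0,∞) with ∫₀^∞ s dν(s) = 1 and g(z) = ∫₀^∞ e^{−zs} dν(s). Then for every z > 0: (g(z) − e^{−z})/z = ∫₀^∞ e^{−zs} H(s) ds, where H(s) = ν([0,s]) − 1_{[1,∞)}(s), and ∫₀^∞ |H(s)| ds = 2 L[g] where L[g] := ∫_{[0,1]} (1−s) dν(s). If moreover g''(0) := ∫₀^∞ s² dν(s) < ∞, then 2 L[g] ≤ (g''(0) − 1)^{1/2}. -/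
open MeasureTheory Real Set Filter

/-- The difference of the distribution functions of the Dirac masses at `t` and at `1`,
evaluated at `s`. -/
noncomputable def stepDiff (s t : ℝ) : ℝ :=
  (Set.Ici t).indicator 1 s - (Set.Ici (1 : ℝ)).indicator 1 s

lemma measurable_stepDiff : Measurable (fun p : ℝ × ℝ => stepDiff p.1 p.2) := by
  have h : (fun p : ℝ × ℝ => stepDiff p.1 p.2) = fun p =>
      {p : ℝ × ℝ | p.2 ≤ p.1}.indicator 1 p - {p : ℝ × ℝ | 1 ≤ p.1}.indicator 1 p := by
    ext p
    simp [stepDiff, Set.indicator]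
  rw [h]
  exact (measurable_one.indicator (measurableSet_le measurable_snd measurable_fst)).sub
    (measurable_one.indicator (measurableSet_le measurable_const measurable_fst))

lemma abs_stepDiff (s t : ℝ) :
    |stepDiff s t| = (Set.Ico (min t 1) (max t 1)).indicator 1 s := by
  simp only [stepDiff, Set.indicator, Set.mem_Ici, Set.mem_Ico, Pi.one_apply, min_le_iff,
    lt_max_iff]
  split_ifs <;> simp <;> grind

lemma integrable_stepDiff_left (t : ℝ) : Integrable (fun s => stepDiff s t) := by
  have hm : Measurable (fun s => stepDiff s t) :=
    measurable_stepDiff.comp (measurable_id.prodMk measurable_const)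
  rw [← integrable_norm_iff hm.aestronglyMeasurable]
  simp_rw [Real.norm_eq_abs, abs_stepDiff]
  rw [integrable_indicator_iff measurableSet_Ico]
  exact integrableOn_const (by simp)

lemma integral_abs_stepDiff {t : ℝ} (ht : 0 ≤ t) :
    ∫ s in Set.Ioi (0 : ℝ), |stepDiff s t| = |t - 1| := by
  simp_rw [abs_stepDiff]
  rw [← integral_Ici_eq_integral_Ioi, setIntegral_indicator measurableSet_Ico,
    Set.inter_eq_right.2 (Set.Ico_subset_Ici_self.trans
      (Set.Ici_subset_Ici.2 (le_min ht zero_le_one)))]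
  simp [max_sub_min_eq_abs, abs_sub_comm]

lemma integrable_stepDiff_prod {ν : Measure ℝ} [IsProbabilityMeasure ν]
    (hpos : ∀ᵐ t ∂ν, 0 ≤ t) (hint : Integrable (fun s => s) ν) :
    Integrable (fun p : ℝ × ℝ => stepDiff p.1 p.2)
      ((volume.restrict (Set.Ioi 0)).prod ν) := by
  rw [integrable_prod_iff' measurable_stepDiff.aestronglyMeasurable]
  refine ⟨.of_forall fun t => (integrable_stepDiff_left t).integrableOn, ?_⟩
  refine (hint.sub (integrable_const 1)).abs.congr ?_
  filter_upwards [hpos] with t ht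
  exact (integral_abs_stepDiff ht).symm

lemma integrableOn_exp_neg_mul_Ici {z : ℝ} (hz : 0 < z) (t : ℝ) :
    IntegrableOn (fun s => Real.exp (-z * s)) (Set.Ici t) := by
  rw [integrableOn_Ici_iff_integrableOn_Ioi]
  exact integrableOn_exp_mul_Ioi (neg_neg_of_pos hz) t

lemma integral_exp_mul_indicator_Ici {z : ℝ} (hz : 0 < z) {t : ℝ} (ht : 0 ≤ t) :
    ∫ s in Set.Ioi (0 : ℝ), Real.exp (-z * s) * (Set.Ici t).indicator 1 s
      = Real.exp (-z * t) / z := by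
  have h (s : ℝ) : Real.exp (-z * s) * (Set.Ici t).indicator 1 s
      = (Set.Ici t).indicator (fun s => Real.exp (-z * s)) s := by
    simp [Set.indicator]
  simp_rw [h]
  rw [← integral_Ici_eq_integral_Ioi, setIntegral_indicator measurableSet_Ici,
    Set.inter_eq_right.2 (Set.Ici_subset_Ici.2 ht), integral_Ici_eq_integral_Ioi,
    integral_exp_mul_Ioi (neg_neg_of_pos hz)]
  rw [neg_div_neg_eq]

lemma integral_exp_mul_stepDiff {z : ℝ} (hz : 0 < z) {t : ℝ} (ht : 0 ≤ t) :
    ∫ s in Set.Ioi (0 : ℝ), Real.exp (-z * s) * stepDiff s t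
      = (Real.exp (-z * t) - Real.exp (-z)) / z := by
  have hI (u : ℝ) : IntegrableOn
      (fun s => Real.exp (-z * s) * (Set.Ici u).indicator 1 s) (Set.Ioi 0) := by
    refine (((integrableOn_exp_neg_mul_Ici hz u).integrable_indicator
      measurableSet_Ici).integrableOn).congr (.of_forall fun s => ?_)
    simp [Set.indicator]
  simp_rw [stepDiff, mul_sub]
  rw [integral_sub (hI t) (hI 1), integral_exp_mul_indicator_Ici hz ht,
    integral_exp_mul_indicator_Ici hz zero_le_one, mul_one, sub_div]

lemma integral_stepDiff {ν : Measure ℝ} [IsProbabilityMeasure ν]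
    (hpos : ∀ᵐ t ∂ν, 0 ≤ t) (s : ℝ) :
    ∫ t, stepDiff s t ∂ν = (ν (Set.Icc 0 s)).toReal - (if 1 ≤ s then 1 else 0) := by
  have h : (fun t => stepDiff s t) =ᵐ[ν]
      fun t => (Set.Icc 0 s).indicator 1 t - (if 1 ≤ s then 1 else 0) := by
    filter_upwards [hpos] with t ht
    simp [stepDiff, Set.indicator, ht]
  have hi : Integrable ((Set.Icc 0 s).indicator (1 : ℝ → ℝ)) ν :=
    (integrable_const (1 : ℝ)).indicator measurableSet_Icc
  rw [integral_congr_ae h, integral_sub hi (integrable_const _),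
    integral_indicator_one measurableSet_Icc]
  simp [Measure.real]

lemma abs_integral_stepDiff (ν : Measure ℝ) (s : ℝ) :
    |∫ t, stepDiff s t ∂ν| = ∫ t, |stepDiff s t| ∂ν := by
  by_cases hs : 1 ≤ s
  · have h (t : ℝ) : stepDiff s t ≤ 0 := by
      simp only [stepDiff, Set.indicator, Set.mem_Ici, hs, if_true, Pi.one_apply]
      split_ifs <;> norm_num
    rw [abs_of_nonpos (integral_nonpos h), ← integral_neg]
    exact integral_congr_ae (.of_forall fun t => (abs_of_nonpos (h t)).symm)
  · have h (t : ℝ) : 0 ≤ stepDiff s t := by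
      simp only [stepDiff, Set.indicator, Set.mem_Ici, hs, if_false, Pi.one_apply]
      split_ifs <;> norm_num
    rw [abs_of_nonneg (integral_nonneg h)]
    exact integral_congr_ae (.of_forall fun t => (abs_of_nonneg (h t)).symm)

lemma integral_abs_sub_one_eq {ν : Measure ℝ} [IsProbabilityMeasure ν]
    (hpos : ∀ᵐ t ∂ν, 0 ≤ t) (hint : Integrable (fun s => s) ν) (hmean : ∫ s, s ∂ν = 1) :
    ∫ t, |t - 1| ∂ν = 2 * ∫ s in Set.Icc (0 : ℝ) 1, (1 - s) ∂ν := by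
  have hsub : Integrable (fun t : ℝ => 1 - t) ν := (integrable_const 1).sub hint
  have h : (fun t : ℝ => |t - 1|) =ᵐ[ν]
      fun t => 2 * (Set.Icc (0 : ℝ) 1).indicator (fun s => 1 - s) t - (1 - t) := by
    filter_upwards [hpos] with t ht
    by_cases h1 : t ≤ 1
    · rw [Set.indicator_of_mem (Set.mem_Icc.2 ⟨ht, h1⟩), abs_of_nonpos (by linarith)]
      ring
    · rw [Set.indicator_of_notMem (fun hm => h1 hm.2), abs_of_nonneg (by linarith)]
      ring
  rw [integral_congr_ae h, integral_sub ((hsub.indicator measurableSet_Icc).const_mul 2) hsub,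
    integral_const_mul, integral_indicator measurableSet_Icc,
    integral_sub (integrable_const 1) hint, hmean]
  simp

lemma integral_abs_sub_one_le_sqrt {ν : Measure ℝ} [IsProbabilityMeasure ν]
    (hint : Integrable (fun s => s) ν) (hmean : ∫ s, s ∂ν = 1)
    (hsq : Integrable (fun s => s ^ 2) ν) :
    ∫ t, |t - 1| ∂ν ≤ Real.sqrt ((∫ s, s ^ 2 ∂ν) - 1) := by
  have hs1 : Integrable (fun t : ℝ => |t - 1|) ν := (hint.sub (integrable_const 1)).abs
  set m := ∫ t, |t - 1| ∂ν with hm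
  apply Real.le_sqrt_of_sq_le
  have h (t : ℝ) : 2 * m * |t - 1| - m ^ 2 ≤ t ^ 2 - (2 * t - 1) := by
    nlinarith [sq_nonneg (|t - 1| - m), sq_abs (t - 1)]
  have hl := (hs1.const_mul (2 * m)).sub (integrable_const (m ^ 2))
  have hr : Integrable (fun t : ℝ => 2 * t - 1) ν := (hint.const_mul 2).sub (integrable_const (1 : ℝ))
  have := integral_mono hl (hsq.sub hr) h
  simp only [Pi.sub_apply] at this
  rw [integral_sub (hs1.const_mul _) (integrable_const _),
    integral_sub hsq hr, integral_sub (hint.const_mul 2) (integrable_const _),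
    integral_const_mul, integral_const_mul, hmean, ← hm] at this
  simp only [integral_const, probReal_univ, one_smul] at this
  linarith



theorem stmt_6
    (ν : Measure ℝ) [IsProbabilityMeasure ν]
    (hsupp : ν (Set.Iio 0) = 0)
    (hint : Integrable (fun s => s) ν)
    (hmean : (∫ s, s ∂ν) = 1)
    (g : ℝ → ℝ) (hg : ∀ z : ℝ, g z = ∫ s, Real.exp (-z * s) ∂ν)
    (H : ℝ → ℝ)
    (hH : ∀ s : ℝ, H s = (ν (Set.Icc 0 s)).toReal - (if 1 ≤ s then 1 else 0)) :
    (∀ z : ℝ, 0 < z →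
        (g z - Real.exp (-z)) / z = ∫ s in Set.Ioi (0:ℝ), Real.exp (-z * s) * H s) ∧
    (∫ s in Set.Ioi (0:ℝ), |H s|) = 2 * ∫ s in Set.Icc (0:ℝ) 1, (1 - s) ∂ν ∧
    (Integrable (fun s => s ^ 2) ν →
       2 * (∫ s in Set.Icc (0:ℝ) 1, (1 - s) ∂ν) ≤ Real.sqrt ((∫ s, s ^ 2 ∂ν) - 1)) := by

  have hpos : ∀ᵐ t ∂ν, 0 ≤ t := by
    rw [ae_iff]
    simpa [Set.Iio] using hsupp
  have hprod := integrable_stepDiff_prod hpos hint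
  have hH' (s : ℝ) : H s = ∫ t, stepDiff s t ∂ν := by rw [hH, integral_stepDiff hpos]
  have hL := integral_abs_sub_one_eq hpos hint hmean
  refine ⟨fun z hz => ?_, ?_, fun hsq => hL ▸ integral_abs_sub_one_le_sqrt hint hmean hsq⟩
  · have hexp : Integrable (fun p : ℝ × ℝ => Real.exp (-z * p.1) * stepDiff p.1 p.2)
        ((volume.restrict (Set.Ioi 0)).prod ν) := by
      refine hprod.mono ((Measurable.mul (by fun_prop)
        measurable_stepDiff).aestronglyMeasurable) ?_
      have h0 : ∀ᵐ p : ℝ × ℝ ∂((volume.restrict (Set.Ioi 0)).prod ν), 0 < p.1 :=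
        Measure.quasiMeasurePreserving_fst.ae (ae_restrict_mem measurableSet_Ioi)
      filter_upwards [h0] with p hp
      rw [norm_mul, Real.norm_eq_abs, Real.abs_exp]
      exact mul_le_of_le_one_left (norm_nonneg _)
        (Real.exp_le_one_iff.2 (by nlinarith))
    have hint_exp : Integrable (fun t => Real.exp (-z * t)) ν := by
      refine (integrable_const (1 : ℝ)).mono' (by fun_prop) ?_
      filter_upwards [hpos] with t ht
      rw [Real.norm_eq_abs, Real.abs_exp]
      exact Real.exp_le_one_iff.2 (by nlinarith)
    simp_rw [hH', ← integral_const_mul]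
    rw [integral_integral_swap hexp, integral_congr_ae (g := fun t =>
      (Real.exp (-z * t) - Real.exp (-z)) / z), integral_div,
      integral_sub hint_exp (integrable_const _), hg]
    · simp
    · filter_upwards [hpos] with t ht
      exact integral_exp_mul_stepDiff hz ht
  · rw [← hL]
    simp_rw [hH', abs_integral_stepDiff]
    rw [integral_integral_swap hprod.abs]
    refine integral_congr_ae ?_
    filter_upwards [hpos] with t ht
    exact integral_abs_stepDiff ht
end

section
/- Let ν be a Borel probability measure on [0,∞) with ∫₀^∞ s dν(s) = 1, g(z) = ∫₀^∞ e^{−zs} dν(s), and g'(z) = −∫₀^∞ s e^{−zs} dν(s). For n ≥ 1 let ν_n be the n-fold convolution of the pushforward of ν under s ↦ s/n, so that g(z/n)ⁿ = ∫₀^∞ e^{−zs} dν_n(s), and set L[g_n] := ∫_{[0,1]} (1−s) dν_n(s). Then for every positive integer n: L[g_n] ≤ 2e (1 + 1/|g'(1/n)|) (1 + g'(1/n))^{1/2}. -/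
open MeasureTheory Real Set Filter

open ProbabilityTheory in
theorem integral_abs_sub_mean_le_sqrt_variance {Ω : Type*} [MeasurableSpace Ω] {μ : Measure Ω}
    [IsProbabilityMeasure μ] {f : Ω → ℝ} (hf : MemLp f 2 μ) :
    ∫ x, |f x - μ[f]| ∂μ ≤ √Var[f; μ] := by
  have hd : MemLp (fun x => |f x - μ[f]|) 2 μ := (hf.sub (memLp_const _)).abs
  have hv := variance_nonneg (fun x => |f x - μ[f]|) μ
  rw [variance_eq_sub hd] at hv
  apply Real.le_sqrt_of_sq_le
  rw [variance_eq_integral hf.1.aemeasurable]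
  simpa using hv

theorem mul_exp_neg_le_self (x : ℝ) {c : ℝ} (hc : 0 ≤ c) : x * exp (-c * x) ≤ x := by
  rcases le_total 0 x with hx | hx
  · exact mul_le_of_le_one_right hx (exp_le_one_iff.2 (by nlinarith))
  · have : 1 ≤ exp (-c * x) := one_le_exp (by nlinarith)
    nlinarith

theorem mul_exp_neg_mul_le_inv {x c : ℝ} (hc : 0 < c) : x * exp (-c * x) ≤ c⁻¹ := by
  have h := add_one_le_exp (c * x)
  have h2 : exp (-c * x) * exp (c * x) = 1 := by rw [← exp_add]; simp
  have h4 := exp_pos (-c * x)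
  rw [← one_div, le_div_iff₀ hc]
  nlinarith

theorem sq_mul_exp_neg_le {x c : ℝ} (hx : 0 ≤ x) (hc : 0 < c) :
    (x * exp (-c * x)) ^ 2 ≤ c⁻¹ * (x - x * exp (-c * x)) := by
  have h := add_one_le_exp (c * x)
  have h2 : exp (-c * x) * exp (c * x) = 1 := by rw [← exp_add]; simp
  have h3 : exp (-c * x) ≤ 1 := exp_le_one_iff.2 (by nlinarith)
  have h4 := exp_pos (-c * x)
  set e := exp (-c * x)
  have h5 : c * x * e ≤ 1 - e := by nlinarith
  have h6 : c * x * e * e ≤ 1 - e := by nlinarith [mul_nonneg (mul_nonneg hc.le hx) h4.le]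
  rw [inv_mul_eq_div, le_div_iff₀ hc]
  nlinarith [mul_le_mul_of_nonneg_left h6 hx]

open ProbabilityTheory in
theorem integral_abs_average_sub_mean_le {Ω : Type*} [MeasurableSpace Ω] {ν : Measure Ω}
    [IsProbabilityMeasure ν] {f : Ω → ℝ} (hf : MemLp f 2 ν) {n : ℕ} (hn : 0 < n) :
    Integrable (fun v : Fin n → Ω => (∑ i, f (v i)) / n) (Measure.pi fun _ => ν) ∧
    ∫ v : Fin n → Ω, |(∑ i, f (v i)) / n - ν[f]| ∂(Measure.pi fun _ => ν) ≤ √(Var[f; ν] / n) := by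
  have hn' : (n : ℝ) ≠ 0 := by positivity
  have hcomp : ∀ i : Fin n, MemLp (fun v : Fin n → Ω => f (v i)) 2 (Measure.pi fun _ => ν) :=
    fun i => hf.comp_measurePreserving (measurePreserving_eval (fun _ => ν) i)
  have hsum : MemLp (fun v : Fin n → Ω => ∑ i, f (v i)) 2 (Measure.pi fun _ => ν) :=
    memLp_finsetSum _ fun i _ => hcomp i
  have havg : MemLp (fun v : Fin n → Ω => (∑ i, f (v i)) / n) 2 (Measure.pi fun _ => ν) := by
    simpa only [div_eq_mul_inv] using hsum.mul_const _
  refine ⟨havg.integrable one_le_two, ?_⟩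
  have hmean : ∫ v : Fin n → Ω, (∑ i, f (v i)) / n ∂(Measure.pi fun _ => ν) = ν[f] := by
    rw [integral_div, integral_finsetSum _ fun i _ => (hcomp i).integrable one_le_two]
    simp_rw [integral_comp_eval (μ := fun _ : Fin n => ν) hf.1]
    simp
    field_simp
  have hvar : Var[fun v : Fin n → Ω => (∑ i, f (v i)) / n; Measure.pi fun _ => ν] =
      Var[f; ν] / n := by
    have h := variance_sum_pi (μ := fun _ : Fin n => ν) (X := fun _ => f) fun _ => hf
    have he : (∑ i : Fin n, fun v : Fin n → Ω => f (v i)) = fun v => ∑ i, f (v i) := by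
      ext v; simp
    rw [he] at h
    simp_rw [div_eq_mul_inv]
    rw [variance_mul_const, h]
    simp
    field_simp
  simpa only [hmean, hvar] using integral_abs_sub_mean_le_sqrt_variance havg

theorem integral_exp_map_average {ν : Measure ℝ} [IsProbabilityMeasure ν] (n : ℕ) (z : ℝ) :
    ∫ s, exp (-z * s) ∂(Measure.map (fun v : Fin n → ℝ => (∑ i, v i) / n)
      (Measure.pi fun _ => ν)) = (∫ s, exp (-(z / n) * s) ∂ν) ^ n := by
  rw [integral_map (by fun_prop) (by fun_prop)]
  have h := integral_fintype_prod_eq_pow (ι := Fin n) (μ := ν) fun s => exp (-(z / n) * s)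
  rw [Fintype.card_fin] at h
  rw [← h]
  congr 1 with v
  rw [← exp_sum, ← Finset.mul_sum]
  congr 1
  ring

open ProbabilityTheory in
theorem setIntegral_one_sub_map_average_le {ν : Measure ℝ} [IsProbabilityMeasure ν] {f : ℝ → ℝ}
    (hf : MemLp f 2 ν) (hle : ∀ x, f x ≤ x) (hmean : ν[f] ≤ 1) {n : ℕ} (hn : 0 < n) :
    ∫ s in Icc (0 : ℝ) 1, (1 - s) ∂(Measure.map (fun v : Fin n → ℝ => (∑ i, v i) / n)
      (Measure.pi fun _ => ν)) ≤ (1 - ν[f]) + √(Var[f; ν] / n) := by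
  obtain ⟨hi, hb⟩ := integral_abs_average_sub_mean_le hf hn
  have hi' : Integrable (fun v : Fin n → ℝ => |(∑ i, f (v i)) / n - ν[f]|)
      (Measure.pi fun _ => ν) := (hi.sub (integrable_const _)).abs
  rw [← integral_indicator measurableSet_Icc, integral_map (by fun_prop)
    ((Measurable.indicator (by fun_prop) measurableSet_Icc).aestronglyMeasurable)]
  calc _ ≤ ∫ v : Fin n → ℝ, ((1 - ν[f]) + |(∑ i, f (v i)) / n - ν[f]|)
        ∂(Measure.pi fun _ => ν) := by
        refine integral_mono_of_nonneg (ae_of_all _ fun v => ?_)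
          ((integrable_const _).add hi') (ae_of_all _ fun v => ?_)
        · exact indicator_nonneg (fun s hs => sub_nonneg.2 hs.2) _
        · have hsum : (∑ i, f (v i)) / n ≤ (∑ i, v i) / n := by
            gcongr with i
            exact hle _
          have habs := neg_abs_le ((∑ i, f (v i)) / n - ν[f])
          refine indicator_apply_le' (fun _ => by linarith) fun _ => ?_
          have := abs_nonneg ((∑ i, f (v i)) / n - ν[f])
          linarith
    _ ≤ _ := by
        rw [integral_add (integrable_const _) hi']
        simpa using hb

theorem stmt_8
    (ν : Measure ℝ) [IsProbabilityMeasure ν]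
    (hsupp : ν (Set.Iio 0) = 0)
    (hint : Integrable (fun s => s) ν)
    (hmean : (∫ s, s ∂ν) = 1)
    (g : ℝ → ℝ) (hg : ∀ z : ℝ, g z = ∫ s, Real.exp (-z * s) ∂ν)
    (g' : ℝ → ℝ) (hg' : ∀ z : ℝ, g' z = -∫ s, s * Real.exp (-z * s) ∂ν)
    (νn : ℕ → Measure ℝ)
    (hνn : ∀ n : ℕ, 0 < n → νn n =
      Measure.map (fun v : Fin n → ℝ => (∑ i, v i) / n) (Measure.pi fun _ => ν)) :
    ∀ n : ℕ, 0 < n →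
      (∀ z : ℝ, 0 ≤ z → g (z / n) ^ n = ∫ s, Real.exp (-z * s) ∂(νn n)) ∧
      (∫ s in Set.Icc (0:ℝ) 1, (1 - s) ∂(νn n)) ≤
        2 * Real.exp 1 * (1 + 1 / |g' (1 / n)|) * Real.sqrt (1 + g' (1 / n)) := by
  intro n hn
  have hn' : (0 : ℝ) < n := by positivity
  rw [hνn n hn]
  refine ⟨fun z _ => by rw [integral_exp_map_average, hg], ?_⟩
  have hnn : ∀ᵐ x ∂ν, 0 ≤ x := by
    rw [ae_iff]
    simpa [Set.Iio] using hsupp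
  have hc : (0 : ℝ) < 1 / n := by positivity
  set c : ℝ := 1 / n with hcdef
  have hcinv : c⁻¹ = n := by simp [hcdef]
  set f : ℝ → ℝ := fun x => x * exp (-c * x) with hf
  have hmem : MemLp f 2 ν := by
    refine MemLp.of_bound (by fun_prop) c⁻¹ (hnn.mono fun x hx => ?_)
    rw [norm_of_nonneg (mul_nonneg hx (exp_pos _).le)]
    exact mul_exp_neg_mul_le_inv hc
  have hfi := hmem.integrable one_le_two
  have hf1 : ∫ x, f x ∂ν ≤ 1 :=
    hmean ▸ integral_mono hfi hint fun x => mul_exp_neg_le_self x hc.le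
  have hf0 : 0 ≤ ∫ x, f x ∂ν :=
    integral_nonneg_of_ae (hnn.mono fun x hx => mul_nonneg hx (exp_pos _).le)
  have hsq : ∫ x, f x ^ 2 ∂ν ≤ n * (1 - ∫ x, f x ∂ν) := by
    rw [← hcinv, ← hmean, ← integral_sub hint hfi, ← integral_const_mul]
    exact integral_mono_ae hmem.integrable_sq ((hint.sub hfi).const_mul _)
      (hnn.mono fun x hx => sq_mul_exp_neg_le hx hc)
  have hvar : ProbabilityTheory.variance f ν / n ≤ 1 - ∫ x, f x ∂ν := by
    rw [div_le_iff₀ hn', mul_comm]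
    exact (ProbabilityTheory.variance_le_expectation_sq hmem.1).trans hsq
  have hL := setIntegral_one_sub_map_average_le hmem
    (fun x => mul_exp_neg_le_self x hc.le) hf1 hn
  have hg1 : 1 + g' c = 1 - ∫ x, f x ∂ν := by rw [hg' c]; ring
  rw [hg1]
  set ε := 1 - ∫ x, f x ∂ν with hε
  have hε0 : 0 ≤ ε := by linarith
  have hs0 := sqrt_nonneg ε
  have hs := sqrt_le_sqrt hvar
  have hεs : ε ≤ √ε := le_sqrt_of_sq_le (by nlinarith)
  have hconst : 2 ≤ 2 * exp 1 * (1 + 1 / |g' c|) := by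
    have h1 : 1 ≤ exp 1 := one_le_exp zero_le_one
    have h2 : 0 ≤ 1 / |g' c| := by positivity
    nlinarith
  nlinarith [mul_le_mul_of_nonneg_right hconst hs0]
end

section
/- Let μ be a positive Borel measure on [0,∞) whose Laplace transform f(t) = ∫₀^∞ e^{−ts} dμ(s) is finite for all t > 0, and assume ∫₀¹ f(s) ds < ∞. Fix γ ∈ (0,1). Then the following are equivalent: (i) there exists c₁ > 0 such that f(τ) ≤ c₁ τ^{−1+γ} for all τ ∈ (0,1); (ii) there exists c₂ > 0 such that μ([0,s]) ≤ c₂ s^{1−γ} for all s ≥ 1; (iii) there exists c₃ > 0 such that ∫₀^{1/n} f(τ) dτ ≤ c₃ n^{−γ} for all positive integers n. -/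
open MeasureTheory Real Set Filter

lemma ae_nonneg_of_measure_Iio_eq_zero {μ : Measure ℝ} (hsupp : μ (Iio 0) = 0) :
    ∀ᵐ s ∂μ, 0 ≤ s := by
  rw [ae_iff]
  simp only [not_le]
  exact hsupp

/-- The Laplace transform of a measure on the positive half-line is decreasing. -/
lemma laplace_le_laplace {μ : Measure ℝ} (hsupp : μ (Iio 0) = 0)
    (hfin : ∀ t : ℝ, 0 < t → Integrable (fun s => Real.exp (-t * s)) μ)
    {t u : ℝ} (ht : 0 < t) (htu : t ≤ u) :
    ∫ s, Real.exp (-u * s) ∂μ ≤ ∫ s, Real.exp (-t * s) ∂μ := by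
  refine integral_mono_ae (hfin u (ht.trans_le htu)) (hfin t ht) ?_
  filter_upwards [ae_nonneg_of_measure_Iio_eq_zero hsupp] with s hs
  apply Real.exp_le_exp.2
  nlinarith

lemma measure_Icc_lt_top_of_integrable_exp {μ : Measure ℝ} {t : ℝ} (ht : 0 < t)
    (hfin : Integrable (fun s => Real.exp (-t * s)) μ) (s : ℝ) : μ (Icc 0 s) < ⊤ := by
  refine (measure_mono ?_).trans_lt (hfin.measure_ge_lt_top (Real.exp_pos (-t * s)))
  intro x hx
  apply Real.exp_le_exp.2
  nlinarith [hx.2]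

/-- The exponential Chebyshev inequality `e^{-ts} μ([0,s]) ≤ ∫ e^{-tx} dμ(x)`. -/
lemma exp_mul_measure_Icc_le_laplace {μ : Measure ℝ} {t : ℝ} (ht : 0 < t)
    (hfin : Integrable (fun s => Real.exp (-t * s)) μ) (s : ℝ) :
    Real.exp (-t * s) * (μ (Icc 0 s)).toReal ≤ ∫ x, Real.exp (-t * x) ∂μ := by
  refine le_trans ?_ (mul_meas_ge_le_integral_of_nonneg
    (ae_of_all _ fun x => (Real.exp_pos (-t * x)).le) hfin (Real.exp (-t * s)))
  refine mul_le_mul_of_nonneg_left ?_ (Real.exp_pos _).le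
  refine ENNReal.toReal_mono (hfin.measure_ge_lt_top (Real.exp_pos _)).ne (measure_mono ?_)
  intro x hx
  apply Real.exp_le_exp.2
  nlinarith [hx.2]

lemma summable_succ_mul_exp_neg : Summable fun k : ℕ => ((k : ℝ) + 1) * Real.exp (-(k : ℝ)) := by
  have h0 := Real.summable_pow_mul_exp_neg_nat_mul 0 one_pos
  have h1 := Real.summable_pow_mul_exp_neg_nat_mul 1 one_pos
  refine (h1.add h0).congr fun k => ?_
  simp only [pow_one, pow_zero, neg_mul, one_mul]
  ring

/-- Slicing the half-line into intervals of length `1/t` bounds the exponential. -/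
lemma ofReal_exp_le_tsum_indicator {t s : ℝ} (ht : 0 < t) (hs : 0 ≤ s) :
    ENNReal.ofReal (Real.exp (-t * s)) ≤ ∑' k : ℕ,
      (Icc (0 : ℝ) (((k : ℝ) + 1) / t)).indicator
        (fun _ => ENNReal.ofReal (Real.exp (-(k : ℝ)))) s := by
  refine le_trans ?_ (ENNReal.le_tsum ⌊t * s⌋₊)
  have hmem : s ∈ Icc (0 : ℝ) (((⌊t * s⌋₊ : ℝ) + 1) / t) := by
    refine ⟨hs, ?_⟩
    rw [le_div_iff₀ ht, mul_comm]
    exact (Nat.lt_floor_add_one (t * s)).le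
  rw [indicator_of_mem hmem]
  refine ENNReal.ofReal_le_ofReal (Real.exp_le_exp.2 ?_)
  have := Nat.floor_le (mul_nonneg ht.le hs)
  linarith

/-- Polynomial growth of `μ([0,s])` controls the blow-up of the Laplace transform at zero. -/
lemma laplace_le_of_measure_Icc_le {μ : Measure ℝ} (hsupp : μ (Iio 0) = 0)
    (hfin : ∀ t : ℝ, 0 < t → Integrable (fun s => Real.exp (-t * s)) μ)
    {γ c : ℝ} (hγ : γ ∈ Ioo (0 : ℝ) 1) (hc : 0 < c)
    (h : ∀ s : ℝ, 1 ≤ s → (μ (Icc 0 s)).toReal ≤ c * s ^ (1 - γ))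
    {τ : ℝ} (hτ : τ ∈ Ioo (0 : ℝ) 1) :
    ∫ s, Real.exp (-τ * s) ∂μ ≤
      c * (∑' k : ℕ, ((k : ℝ) + 1) * Real.exp (-(k : ℝ))) * τ ^ (-1 + γ) := by
  have hτp : 0 < τ ^ (-1 + γ) := Real.rpow_pos_of_pos hτ.1 _
  have hC : 0 ≤ ∑' k : ℕ, ((k : ℝ) + 1) * Real.exp (-(k : ℝ)) :=
    tsum_nonneg fun k => by positivity
  rw [integral_eq_lintegral_of_nonneg_ae (ae_of_all _ fun x => (Real.exp_pos _).le)
    (hfin τ hτ.1).aestronglyMeasurable]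
  refine ENNReal.toReal_le_of_le_ofReal (by positivity) ?_
  have hterm : ∀ k : ℕ, (μ (Icc 0 (((k : ℝ) + 1) / τ))) ≤
      ENNReal.ofReal (c * τ ^ (-1 + γ) * ((k : ℝ) + 1)) := by
    intro k
    rw [ENNReal.le_ofReal_iff_toReal_le
      (measure_Icc_lt_top_of_integrable_exp one_pos (hfin 1 one_pos) _).ne (by positivity)]
    have hk : (1 : ℝ) ≤ (k : ℝ) + 1 := by linarith [(Nat.cast_nonneg k : (0 : ℝ) ≤ k)]
    have hk1 : 1 ≤ ((k : ℝ) + 1) / τ := by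
      rw [le_div_iff₀ hτ.1]
      linarith [hτ.2]
    refine (h _ hk1).trans ?_
    rw [mul_assoc]
    refine mul_le_mul_of_nonneg_left ?_ hc.le
    rw [div_eq_mul_inv, Real.mul_rpow (by positivity) (inv_nonneg.2 hτ.1.le),
      Real.inv_rpow hτ.1.le, ← Real.rpow_neg hτ.1.le, mul_comm, neg_sub, sub_eq_neg_add]
    refine mul_le_mul_of_nonneg_left ?_ hτp.le
    calc ((k : ℝ) + 1) ^ (1 - γ) ≤ ((k : ℝ) + 1) ^ (1 : ℝ) :=
          Real.rpow_le_rpow_of_exponent_le hk (by linarith [hγ.1])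
      _ = _ := Real.rpow_one _
  calc ∫⁻ s, ENNReal.ofReal (Real.exp (-τ * s)) ∂μ
      ≤ ∫⁻ s, ∑' k : ℕ, (Icc (0 : ℝ) (((k : ℝ) + 1) / τ)).indicator
          (fun _ => ENNReal.ofReal (Real.exp (-(k : ℝ)))) s ∂μ := by
        refine lintegral_mono_ae ?_
        filter_upwards [ae_nonneg_of_measure_Iio_eq_zero hsupp] with s hs
        exact ofReal_exp_le_tsum_indicator hτ.1 hs
    _ = ∑' k : ℕ, ENNReal.ofReal (Real.exp (-(k : ℝ))) * μ (Icc 0 (((k : ℝ) + 1) / τ)) := by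
        rw [lintegral_tsum fun k => (measurable_const.indicator measurableSet_Icc).aemeasurable]
        simp only [lintegral_indicator_const measurableSet_Icc]
    _ ≤ ∑' k : ℕ, ENNReal.ofReal
          (c * τ ^ (-1 + γ) * (((k : ℝ) + 1) * Real.exp (-(k : ℝ)))) := by
        refine ENNReal.tsum_le_tsum fun k => ?_
        rw [← mul_assoc, mul_comm _ (Real.exp (-(k : ℝ))), ENNReal.ofReal_mul (Real.exp_pos _).le]
        gcongr
        exact hterm k
    _ = ENNReal.ofReal
          (c * (∑' k : ℕ, ((k : ℝ) + 1) * Real.exp (-(k : ℝ))) * τ ^ (-1 + γ)) := by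
        rw [← ENNReal.ofReal_tsum_of_nonneg (fun k => by positivity)
          (summable_succ_mul_exp_neg.mul_left _), tsum_mul_left]
        congr 1
        ring

/-- Integrating a power bound on `(0, b)`. -/
lemma setIntegral_Ioo_le_of_le_rpow {f : ℝ → ℝ} {c γ b : ℝ} (hγ : 0 < γ) (hb : 0 < b)
    (hf : IntegrableOn f (Ioo 0 b)) (h : ∀ τ ∈ Ioo (0 : ℝ) b, f τ ≤ c * τ ^ (-1 + γ)) :
    ∫ τ in Ioo (0 : ℝ) b, f τ ≤ c / γ * b ^ γ := by
  have hr : -1 < -1 + γ := by linarith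
  have hI : IntegrableOn (fun τ : ℝ => c * τ ^ (-1 + γ)) (Ioo 0 b) := by
    have := (intervalIntegral.intervalIntegrable_rpow' (a := 0) (b := b) hr).const_mul c
    rw [intervalIntegrable_iff_integrableOn_Ioo_of_le hb.le] at this
    exact this
  refine (setIntegral_mono_on hf hI measurableSet_Ioo h).trans_eq ?_
  rw [← integral_Ioc_eq_integral_Ioo, ← intervalIntegral.integral_of_le hb.le,
    intervalIntegral.integral_const_mul, integral_rpow (Or.inl hr), neg_add_cancel_comm,
    Real.zero_rpow hγ.ne']
  ring

/-- If `f ≥ f τ` on `(0, τ)`, then `f τ` is at most the mean of `f` over `(0, τ)`. -/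
lemma mul_le_setIntegral_Ioo {f : ℝ → ℝ} {τ : ℝ} (hτ : 0 < τ)
    (hf : IntegrableOn f (Ioo 0 τ)) (h : ∀ u ∈ Ioo (0 : ℝ) τ, f τ ≤ f u) :
    τ * f τ ≤ ∫ u in Ioo (0 : ℝ) τ, f u := by
  have := setIntegral_mono_on (μ := volume) (integrableOn_const (C := f τ) (s := Ioo 0 τ)
    (by simp) (by simp)) hf measurableSet_Ioo h
  simpa [hτ.le] using this

theorem stmt_9
    (μ : Measure ℝ) (hsupp : μ (Set.Iio 0) = 0)
    (hfin : ∀ t : ℝ, 0 < t → Integrable (fun s => Real.exp (-t * s)) μ)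
    (f : ℝ → ℝ) (hf : ∀ t : ℝ, f t = ∫ s, Real.exp (-t * s) ∂μ)
    (hint : IntegrableOn f (Set.Ioo 0 1))
    (γ : ℝ) (hγ : γ ∈ Set.Ioo (0:ℝ) 1) :
    ((∃ c₁ > (0:ℝ), ∀ τ ∈ Set.Ioo (0:ℝ) 1, f τ ≤ c₁ * τ ^ (-1 + γ)) ↔
      (∃ c₂ > (0:ℝ), ∀ s : ℝ, 1 ≤ s → (μ (Set.Icc 0 s)).toReal ≤ c₂ * s ^ (1 - γ))) ∧
    ((∃ c₂ > (0:ℝ), ∀ s : ℝ, 1 ≤ s → (μ (Set.Icc 0 s)).toReal ≤ c₂ * s ^ (1 - γ)) ↔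
      (∃ c₃ > (0:ℝ), ∀ n : ℕ, 0 < n →
        (∫ τ in Set.Ioo (0:ℝ) (1 / (n:ℝ)), f τ) ≤ c₃ * (n:ℝ) ^ (-γ))) := by
  have hf0 : ∀ t, 0 ≤ f t := fun t => by
    rw [hf]
    exact integral_nonneg fun s => (Real.exp_pos _).le
  have hmeasure : (∃ c₁ > (0:ℝ), ∀ τ ∈ Set.Ioo (0:ℝ) 1, f τ ≤ c₁ * τ ^ (-1 + γ)) ↔
      (∃ c₂ > (0:ℝ), ∀ s : ℝ, 1 ≤ s → (μ (Set.Icc 0 s)).toReal ≤ c₂ * s ^ (1 - γ)) := by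
    constructor
    · rintro ⟨c, hc, h⟩
      refine ⟨Real.exp 2⁻¹ * (c * 2 ^ (1 - γ)), by positivity, fun s hs => ?_⟩
      have hs0 : 0 < s := by linarith
      have ht : 0 < (2 * s)⁻¹ := by positivity
      have h1 := exp_mul_measure_Icc_le_laplace ht (hfin _ ht) s
      rw [← hf] at h1
      have h2 := h (2 * s)⁻¹ ⟨ht, inv_lt_one_of_one_lt₀ (by linarith)⟩
      rw [Real.inv_rpow (by positivity), ← Real.rpow_neg (by positivity), neg_add, neg_neg,
        ← sub_eq_add_neg, Real.mul_rpow (by norm_num) hs0.le] at h2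
      have he : -(2 * s)⁻¹ * s = -2⁻¹ := by field_simp
      rw [he, Real.exp_neg, inv_mul_le_iff₀ (Real.exp_pos _)] at h1
      calc (μ (Set.Icc 0 s)).toReal ≤ Real.exp 2⁻¹ * f (2 * s)⁻¹ := h1
        _ ≤ Real.exp 2⁻¹ * (c * (2 ^ (1 - γ) * s ^ (1 - γ))) := by gcongr
        _ = _ := by ring
    · rintro ⟨c, hc, h⟩
      refine ⟨c * ∑' k : ℕ, ((k : ℝ) + 1) * Real.exp (-(k : ℝ)), mul_pos hc ?_, fun τ hτ => ?_⟩
      · exact summable_succ_mul_exp_neg.tsum_pos (fun k => by positivity) 0 (by positivity)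
      · rw [hf]
        exact laplace_le_of_measure_Icc_le hsupp hfin hγ hc h hτ
  refine ⟨hmeasure, hmeasure.symm.trans ⟨?_, ?_⟩⟩
  · rintro ⟨c, hc, h⟩
    refine ⟨c / γ, div_pos hc hγ.1, fun n hn => ?_⟩
    have hn0 : (0 : ℝ) < n := Nat.cast_pos.2 hn
    have hn1 : 1 / (n : ℝ) ≤ 1 := (div_le_one hn0).2 (Nat.one_le_cast.2 hn)
    have hsub : Ioo (0 : ℝ) (1 / n) ⊆ Ioo 0 1 := Ioo_subset_Ioo_right hn1
    refine (setIntegral_Ioo_le_of_le_rpow hγ.1 (by positivity) (hint.mono_set hsub)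
      fun τ hτ => h τ (hsub hτ)).trans_eq ?_
    rw [one_div, Real.inv_rpow hn0.le, Real.rpow_neg hn0.le]
  · rintro ⟨c, hc, h⟩
    refine ⟨c * 2 ^ γ, by positivity, fun τ hτ => ?_⟩
    have hτ0 : 0 < τ := hτ.1
    have h1 : 1 ≤ τ⁻¹ := (one_le_inv₀ hτ0).2 hτ.2.le
    have hn : 0 < ⌊τ⁻¹⌋₊ := Nat.floor_pos.2 h1
    have hn0 : (0 : ℝ) < ⌊τ⁻¹⌋₊ := Nat.cast_pos.2 hn
    have hn1 : (1 : ℝ) ≤ ⌊τ⁻¹⌋₊ := Nat.one_le_cast.2 hn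
    have hτn : τ ≤ 1 / (⌊τ⁻¹⌋₊ : ℝ) := by
      rw [one_div, le_inv_comm₀ hτ0 hn0]
      exact Nat.floor_le (by positivity)
    have hlow : (2 * τ)⁻¹ ≤ (⌊τ⁻¹⌋₊ : ℝ) := by
      rw [mul_inv]
      linarith [Nat.lt_floor_add_one τ⁻¹]
    have hint' : IntegrableOn f (Ioo 0 (1 / (⌊τ⁻¹⌋₊ : ℝ))) :=
      hint.mono_set (Ioo_subset_Ioo_right ((div_le_one hn0).2 hn1))
    have hsub : Ioo (0 : ℝ) τ ⊆ Ioo 0 (1 / (⌊τ⁻¹⌋₊ : ℝ)) := Ioo_subset_Ioo_right hτn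
    have key : τ * f τ ≤ c * (2 ^ γ * τ ^ γ) :=
      calc τ * f τ ≤ ∫ u in Ioo (0 : ℝ) τ, f u :=
            mul_le_setIntegral_Ioo hτ0 (hint'.mono_set hsub) fun u hu => by
              rw [hf, hf]
              exact laplace_le_laplace hsupp hfin hu.1 hu.2.le
        _ ≤ ∫ u in Ioo (0 : ℝ) (1 / (⌊τ⁻¹⌋₊ : ℝ)), f u :=
            setIntegral_mono_set hint' (ae_of_all _ hf0) hsub.eventuallyLE
        _ ≤ c * (⌊τ⁻¹⌋₊ : ℝ) ^ (-γ) := h _ hn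
        _ ≤ c * ((2 * τ)⁻¹) ^ (-γ) := by
            refine mul_le_mul_of_nonneg_left ?_ hc.le
            exact Real.rpow_le_rpow_of_nonpos (by positivity) hlow (by linarith [hγ.1])
        _ = c * (2 ^ γ * τ ^ γ) := by
            rw [Real.inv_rpow (by positivity), Real.rpow_neg (by positivity), inv_inv,
              Real.mul_rpow (by norm_num) hτ0.le]
    rw [Real.rpow_add hτ0, Real.rpow_neg_one]
    calc f τ = τ⁻¹ * (τ * f τ) := by field_simp
      _ ≤ τ⁻¹ * (c * (2 ^ γ * τ ^ γ)) := by gcongr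
      _ = _ := by ring
end

section
/- Let g be completely monotone on (0,∞), i.e. g(z) = ∫₀^∞ e^{−zs} dμ(s) for a positive Borel measure μ, and suppose I_k := ∫₀^∞ g(t)ᵏ dt < ∞ for some positive integer k. Then for every z > 0: g(z)ᵏ ≤ I_k / z, and g(z)^{k+1} ≤ k · I_k · |g'(z)|, where g'(z) = −∫₀^∞ s e^{−zs} dμ(s). -/
open MeasureTheory Real Set Filter

theorem integrable_mul_exp_neg_mul_s12 {μ : Measure ℝ} (hsupp : μ (Set.Iio 0) = 0)
    (hfin : ∀ z : ℝ, 0 < z → Integrable (fun s => Real.exp (-z * s)) μ) {z : ℝ} (hz : 0 < z) :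
    Integrable (fun s => s * Real.exp (-z * s)) μ := by
  refine ((hfin (z / 2) (by positivity)).const_mul (2 / z)).mono'
    (by fun_prop) ?_
  have hs : ∀ᵐ s ∂μ, 0 ≤ s := by
    filter_upwards [measure_eq_zero_iff_ae_notMem.1 hsupp] with s hs using not_lt.1 hs
  filter_upwards [hs] with s hs
  rw [norm_of_nonneg (by positivity)]
  have h1 : s ≤ 2 / z * Real.exp (z / 2 * s) := by
    have := add_one_le_exp (z / 2 * s)
    calc s = 2 / z * (z / 2 * s) := by field_simp
      _ ≤ _ := by gcongr; linarith
  calc s * Real.exp (-z * s) ≤ 2 / z * Real.exp (z / 2 * s) * Real.exp (-z * s) := by gcongr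
    _ = 2 / z * Real.exp (-(z / 2) * s) := by
      rw [mul_assoc, ← Real.exp_add]; ring_nf

/-- The logarithmic convexity of a Laplace transform, in tangent-line form. -/
theorem mul_exp_le_integral_exp_neg_mul {μ : Measure ℝ} (hsupp : μ (Set.Iio 0) = 0)
    (hfin : ∀ z : ℝ, 0 < z → Integrable (fun s => Real.exp (-z * s)) μ)
    {z t c : ℝ} (hz : 0 < z) (ht : 0 < t)
    (hc : ∫ s, s * Real.exp (-z * s) ∂μ = c * ∫ s, Real.exp (-z * s) ∂μ) :
    (∫ s, Real.exp (-z * s) ∂μ) * Real.exp (-c * (t - z)) ≤ ∫ s, Real.exp (-t * s) ∂μ := by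
  have hd := integrable_mul_exp_neg_mul_s12 hsupp hfin hz
  have hle : ∀ s, Real.exp (-c * (t - z)) *
      ((1 + (t - z) * c) * Real.exp (-z * s) - (t - z) * (s * Real.exp (-z * s)))
      ≤ Real.exp (-t * s) := fun s => by
    have h := add_one_le_exp (-(t - z) * (s - c))
    calc _ = Real.exp (-c * (t - z)) * Real.exp (-z * s) * (-(t - z) * (s - c) + 1) := by ring
      _ ≤ Real.exp (-c * (t - z)) * Real.exp (-z * s) * Real.exp (-(t - z) * (s - c)) := by gcongr
      _ = _ := by rw [← Real.exp_add, ← Real.exp_add]; ring_nf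
  have hi := ((hfin z hz).const_mul (1 + (t - z) * c)).sub (hd.const_mul (t - z))
  have h := integral_mono (hi.const_mul (Real.exp (-c * (t - z)))) (hfin t ht) hle
  simp only [Pi.sub_apply] at h
  rw [integral_const_mul, integral_sub ((hfin z hz).const_mul _) (hd.const_mul _),
    integral_const_mul, integral_const_mul, hc] at h
  linarith

theorem stmt_12
    (μ : Measure ℝ) (hsupp : μ (Set.Iio 0) = 0)
    (hfin : ∀ z : ℝ, 0 < z → Integrable (fun s => Real.exp (-z * s)) μ)
    (g : ℝ → ℝ) (hg : ∀ z : ℝ, g z = ∫ s, Real.exp (-z * s) ∂μ)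
    (g' : ℝ → ℝ) (hg' : ∀ z : ℝ, g' z = -∫ s, s * Real.exp (-z * s) ∂μ)
    (k : ℕ) (hk : 0 < k)
    (hIk : IntegrableOn (fun t => g t ^ k) (Set.Ioi 0)) :
    ∀ z : ℝ, 0 < z →
      g z ^ k ≤ (∫ t in Set.Ioi (0:ℝ), g t ^ k) / z ∧
      g z ^ (k + 1) ≤ k * (∫ t in Set.Ioi (0:ℝ), g t ^ k) * |g' z| := by
  have hs : ∀ᵐ s ∂μ, 0 ≤ s := by
    filter_upwards [measure_eq_zero_iff_ae_notMem.1 hsupp] with s hs using not_lt.1 hs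
  have hnn : ∀ z, 0 ≤ g z := fun z => by
    rw [hg]; exact integral_nonneg fun s => (Real.exp_pos _).le
  have hanti : ∀ {x y : ℝ}, 0 < x → x ≤ y → g y ≤ g x := fun {x y} hx hxy => by
    rw [hg, hg]
    refine integral_mono_ae (hfin y (hx.trans_le hxy)) (hfin x hx) ?_
    filter_upwards [hs] with s hs
    gcongr
  have hpow : ∀ z : ℝ, 0 < z → g z ^ k * z ≤ ∫ t in Set.Ioi (0:ℝ), g t ^ k := fun z hz => by
    calc g z ^ k * z = ∫ _ in Set.Ioc (0:ℝ) z, g z ^ k := by simp [hz.le, mul_comm]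
      _ ≤ ∫ t in Set.Ioc (0:ℝ) z, g t ^ k :=
        setIntegral_mono_on (by simp) (hIk.mono_set Ioc_subset_Ioi_self) measurableSet_Ioc
          fun t ht => pow_le_pow_left₀ (hnn z) (hanti ht.1 ht.2) k
      _ ≤ _ := setIntegral_mono_set hIk (ae_of_all _ fun t => pow_nonneg (hnn t) k)
        (ae_of_all _ Ioc_subset_Ioi_self)
  intro z hz
  refine ⟨(le_div_iff₀ hz).2 (hpow z hz), ?_⟩
  rcases (hnn z).eq_or_lt with h0 | hpos
  · rw [← h0, zero_pow k.succ_ne_zero]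
    have := setIntegral_nonneg (μ := volume) (measurableSet_Ioi (a := (0:ℝ)))
      fun t _ => pow_nonneg (hnn t) k
    positivity
  have hD : 0 ≤ ∫ s, s * Real.exp (-z * s) ∂μ := integral_nonneg_of_ae <| by
    filter_upwards [hs] with s hs
    simp only [Pi.zero_apply]
    positivity
  rw [hg', abs_neg, abs_of_nonneg hD]
  obtain ⟨c, hc⟩ : ∃ c, ∫ s, s * Real.exp (-z * s) ∂μ = c * g z :=
    ⟨_, (div_mul_cancel₀ _ hpos.ne').symm⟩
  have hc0 : 0 ≤ c := nonneg_of_mul_nonneg_left (hc ▸ hD) hpos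
  have htan : ∀ t : ℝ, 0 < t → g z * Real.exp (-c * t) ≤ g t := fun t ht => by
    have h := mul_exp_le_integral_exp_neg_mul hsupp hfin hz ht (hc.trans (by rw [hg]))
    rw [← hg, ← hg] at h
    refine (mul_le_mul_of_nonneg_left (Real.exp_le_exp.2 ?_) hpos.le).trans h
    nlinarith [mul_nonneg hc0 hz.le]
  rw [hc]
  have hk' : (0:ℝ) < k := by exact_mod_cast hk
  rcases hc0.eq_or_lt with rfl | hcpos
  · exfalso
    have hgz : 0 < g z ^ k := by positivity
    have hle : ∀ t : ℝ, 0 < t → g z ^ k * t ≤ ∫ t in Set.Ioi (0:ℝ), g t ^ k := fun t ht =>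
      (mul_le_mul_of_nonneg_right
        (pow_le_pow_left₀ hpos.le (by simpa using htan t ht) k) ht.le).trans (hpow t ht)
    set I := ∫ t in Set.Ioi (0:ℝ), g t ^ k
    have hI : 0 < I := (mul_pos hgz hz).trans_le (hle z hz)
    have h := hle ((I + 1) / g z ^ k) (by positivity)
    rw [mul_div_cancel₀ _ hgz.ne'] at h
    linarith
  have hneg : -(k * c) < 0 := by linarith [mul_pos hk' hcpos]
  have hI : g z ^ k * (1 / (k * c)) ≤ ∫ t in Set.Ioi (0:ℝ), g t ^ k := by
    calc g z ^ k * (1 / (k * c)) = ∫ t in Set.Ioi (0:ℝ), g z ^ k * Real.exp (-(k * c) * t) := by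
          rw [integral_const_mul, integral_exp_mul_Ioi hneg]; simp
      _ ≤ _ := setIntegral_mono_on ((integrableOn_exp_mul_Ioi hneg 0).const_mul _) hIk
          measurableSet_Ioi fun t ht => ?_
    have h := pow_le_pow_left₀ (by positivity) (htan t ht) k
    rwa [mul_pow, ← Real.exp_nat_mul, ← mul_assoc, mul_neg] at h
  calc g z ^ (k + 1) = k * (g z ^ k * (1 / (k * c))) * (c * g z) := by field_simp; ring
    _ ≤ _ := by gcongr
end

section
/- For every α ∈ (0,1) and every positive integer n: (1/Γ(2−α)) ∫₀^∞ ( (1 + z/n)^{−n} − e^{−z} ) z^{−1−α} dz = (1/(α(1−α))) ( 1 − Γ(n+α)/(n^α Γ(n)) ), where Γ is the Gamma function. -/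
open MeasureTheory Real Set Filter

/-- The beta integral of the second kind, with a scale parameter `c`. -/
theorem integrableOn_and_integral_rpow_mul_one_div_one_add_div_rpow {a s c : ℝ}
    (ha : 0 < a) (has : a < s) (hc : 0 < c) :
    IntegrableOn (fun z : ℝ => z ^ (a - 1) * (1 / (1 + z / c)) ^ s) (Ioi 0) ∧
      ∫ z in Ioi (0:ℝ), z ^ (a - 1) * (1 / (1 + z / c)) ^ s =
        c ^ a * Real.Gamma a * Real.Gamma (s - a) / Real.Gamma s := by
  have hs : 0 < s := ha.trans has
  have hΓ : 0 < Real.Gamma s := Real.Gamma_pos_of_pos hs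
  set μ : Measure ℝ := volume.restrict (Ioi (0:ℝ))
  let K : ℝ → ℝ → ℝ := fun z t => z ^ (a - 1) * (t ^ (s - 1) * exp (-((1 + z / c) * t)))
  have hKm : Measurable (Function.uncurry K) := by
    unfold K Function.uncurry
    fun_prop
  have hKt : ∀ z ∈ Ioi (0:ℝ),
      ∫ t, K z t ∂μ = Real.Gamma s * (z ^ (a - 1) * (1 / (1 + z / c)) ^ s) := by
    intro z hz
    have hz : 0 < z := hz
    have h1 : 0 < 1 + z / c := by positivity
    simp only [K, μ]
    rw [integral_const_mul, Real.integral_rpow_mul_exp_neg_mul_Ioi hs h1]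
    ring
  have hKz' : ∀ t z, K z t = t ^ (s - 1) * exp (-t) * (z ^ (a - 1) * exp (-(t / c * z))) := by
    intro t z
    simp only [K]
    rw [show -((1 + z / c) * t) = -t + -(t / c * z) by ring, exp_add]
    ring
  have hKz : ∀ t ∈ Ioi (0:ℝ),
      ∫ z, K z t ∂μ = c ^ a * Real.Gamma a * (exp (-t) * t ^ (s - a - 1)) := by
    intro t ht
    have ht : 0 < t := ht
    simp only [hKz', μ]
    rw [integral_const_mul, Real.integral_rpow_mul_exp_neg_mul_Ioi ha (by positivity),
      one_div_div, div_rpow hc.le ht.le, show s - a - 1 = s - 1 - a by ring, rpow_sub ht _ a]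
    ring
  have hnn : ∀ t ∈ Ioi (0:ℝ), ∀ z ∈ Ioi (0:ℝ), 0 ≤ K z t := by
    intro t ht z hz
    have ht : 0 < t := ht
    have hz : 0 < z := hz
    simp only [K]
    positivity
  have hGi := (Real.GammaIntegral_convergent (sub_pos.2 has)).const_mul (c ^ a * Real.Gamma a)
  have hK : Integrable (Function.uncurry K) (μ.prod μ) := by
    rw [integrable_prod_iff' hKm.aestronglyMeasurable]
    constructor
    · refine ae_restrict_of_forall_mem measurableSet_Ioi fun t ht => ?_
      have ht' : 0 < t := ht
      apply Integrable.of_integral_ne_zero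
      simp only [Function.uncurry]
      rw [hKz t ht]
      have := Real.Gamma_pos_of_pos ha
      positivity
    · refine hGi.congr ?_
      refine ae_restrict_of_forall_mem measurableSet_Ioi fun t ht => ?_
      simp only [Function.uncurry]
      rw [← hKz t ht]
      refine setIntegral_congr_fun measurableSet_Ioi fun z hz => ?_
      exact (norm_of_nonneg (hnn t ht z hz)).symm
  have hI := hK.integral_prod_left
  have hsw := integral_integral_swap hK
  have e1 : ∫ z, (∫ t, K z t ∂μ) ∂μ =
      Real.Gamma s * ∫ z in Ioi (0:ℝ), z ^ (a - 1) * (1 / (1 + z / c)) ^ s := by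
    rw [← integral_const_mul]
    exact setIntegral_congr_fun measurableSet_Ioi hKt
  have e2 : ∫ t, (∫ z, K z t ∂μ) ∂μ = c ^ a * Real.Gamma a * Real.Gamma (s - a) := by
    rw [Real.Gamma_eq_integral (sub_pos.2 has), ← integral_const_mul]
    exact setIntegral_congr_fun measurableSet_Ioi hKz
  constructor
  · refine (hI.const_mul (Real.Gamma s)⁻¹).congr ?_
    refine ae_restrict_of_forall_mem measurableSet_Ioi fun z hz => ?_
    simp only [Function.uncurry]
    rw [hKt z hz]
    field_simp
  · rw [eq_div_iff hΓ.ne', ← e2, ← hsw, e1, mul_comm]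

/-- Euler's approximation of `exp (-z)` is at least `exp (-z)` and the error is at most
`min z 1`. -/
theorem inv_one_add_div_pow_sub_exp_neg_bounds {n : ℕ} (hn : 0 < n) {z : ℝ} (hz : 0 < z) :
    0 ≤ ((1 + z / n) ^ n)⁻¹ - exp (-z) ∧ ((1 + z / n) ^ n)⁻¹ - exp (-z) ≤ z ∧
      ((1 + z / n) ^ n)⁻¹ - exp (-z) ≤ 1 := by
  have hn' : (0:ℝ) < n := by exact_mod_cast hn
  have h1 : 1 ≤ 1 + z / n := by
    have : 0 < z / n := by positivity
    linarith
  have h2 : ((1 + z / n) ^ n)⁻¹ ≤ 1 := inv_le_one_of_one_le₀ (one_le_pow₀ h1)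
  have h3 : (1 + z / n) ^ n ≤ exp z := by
    calc (1 + z / n) ^ n ≤ exp (z / n) ^ n := by
          gcongr
          linarith [add_one_le_exp (z / n)]
      _ = exp z := by
          rw [← exp_nat_mul]
          congr 1
          field_simp
  have h4 : exp (-z) ≤ ((1 + z / n) ^ n)⁻¹ := by
    rw [exp_neg]
    gcongr
  have h5 := add_one_le_exp (-z)
  have h6 := exp_pos (-z)
  refine ⟨by linarith, by linarith, by linarith⟩

theorem integrableOn_inv_one_add_div_pow_sub_exp_neg_mul_rpow {α : ℝ} (h0 : 0 < α) (h1 : α < 1)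
    {n : ℕ} (hn : 0 < n) :
    IntegrableOn (fun z : ℝ => (((1 + z / n) ^ n)⁻¹ - exp (-z)) * z ^ (-1 - α)) (Ioi 0) := by
  have hm : Measurable fun z : ℝ => (((1 + z / n) ^ n)⁻¹ - exp (-z)) * z ^ (-1 - α) := by
    fun_prop
  rw [← Ioc_union_Ioi_eq_Ioi (zero_le_one' ℝ), integrableOn_union]
  constructor
  · have hi : IntegrableOn (fun z : ℝ => z ^ (-α)) (Ioc 0 1) := by
      rw [← intervalIntegrable_iff_integrableOn_Ioc_of_le zero_le_one]
      exact intervalIntegral.intervalIntegrable_rpow' (by linarith)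
    refine hi.mono' hm.aestronglyMeasurable ?_
    refine ae_restrict_of_forall_mem measurableSet_Ioc fun z hz => ?_
    have hz : 0 < z := hz.1
    obtain ⟨b0, b1, -⟩ := inv_one_add_div_pow_sub_exp_neg_bounds hn hz
    rw [norm_of_nonneg (by positivity)]
    calc _ ≤ z * z ^ (-1 - α) := by gcongr
      _ = z ^ (-α) := by
          rw [← rpow_one_add' hz.le (by linarith)]
          congr 1
          ring
  · have hi := integrableOn_Ioi_rpow_of_lt (show -1 - α < -1 by linarith) one_pos
    refine hi.mono' hm.aestronglyMeasurable ?_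
    refine ae_restrict_of_forall_mem measurableSet_Ioi fun z hz => ?_
    have hz : 0 < z := one_pos.trans hz
    obtain ⟨b0, -, b1⟩ := inv_one_add_div_pow_sub_exp_neg_bounds hn hz
    rw [norm_of_nonneg (by positivity)]
    exact mul_le_of_le_one_left (by positivity) b1

theorem stmt_15 :
    ∀ α ∈ Set.Ioo (0:ℝ) 1, ∀ n : ℕ, 0 < n →
      (1 / Real.Gamma (2 - α)) *
          (∫ z in Set.Ioi (0:ℝ), (((1 + z / n) ^ n)⁻¹ - Real.exp (-z)) * z ^ (-1 - α))
        = (1 / (α * (1 - α))) *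
            (1 - Real.Gamma (n + α) / ((n:ℝ) ^ α * Real.Gamma n)) := by
  rintro α ⟨h0, h1⟩ n hn
  have hn' : (0:ℝ) < n := by exact_mod_cast hn
  have hα : 0 < 1 - α := by linarith
  obtain ⟨hBi, hB⟩ := integrableOn_and_integral_rpow_mul_one_div_one_add_div_rpow
    (a := 1 - α) (s := n + 1) (c := n) hα (by linarith) hn'
  have hGi := Real.GammaIntegral_convergent hα
  have hG := Real.Gamma_eq_integral hα
  set u : ℝ → ℝ := fun z => ((1 + z / n) ^ n)⁻¹ - exp (-z)
  set u' : ℝ → ℝ := fun z => exp (-z) - (1 / (1 + z / n)) ^ ((n:ℝ) + 1)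
  set v : ℝ → ℝ := fun z => z ^ (-α) / (-α)
  set v' : ℝ → ℝ := fun z => z ^ (-1 - α)
  have hu : ∀ z ∈ Ioi (0:ℝ), HasDerivAt u (u' z) z := by
    intro z hz
    have hz : 0 < z := hz
    have hp : 0 < 1 + z / n := by positivity
    have d1 : HasDerivAt (fun z : ℝ => 1 + z / n) (1 / n) z :=
      ((hasDerivAt_id z).div_const _).const_add _
    have d2 := (d1.pow n).inv (pow_pos hp n).ne'
    have d3 := (hasDerivAt_neg z).exp
    refine (d2.sub d3).congr_deriv ?_
    simp only [u']
    have e : (n:ℝ) + 1 = ((n + 1 : ℕ) : ℝ) := by push_cast; ring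
    rw [e, rpow_natCast]
    obtain ⟨m, rfl⟩ : ∃ m, n = m + 1 := ⟨n - 1, by omega⟩
    have hp' := hp.ne'
    simp only [Pi.pow_apply, Nat.add_sub_cancel, one_div_pow]
    generalize 1 + z / ((m + 1 : ℕ) : ℝ) = w at *
    field_simp
    ring
  have hv : ∀ z ∈ Ioi (0:ℝ), HasDerivAt v (v' z) z := by
    intro z hz
    have hz : 0 < z := hz
    refine ((hasDerivAt_rpow_const (p := -α) (Or.inl hz.ne')).div_const (-α)).congr_deriv ?_
    simp only [v']
    rw [show -α - 1 = -1 - α by ring]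
    field_simp
  have hu'v_eq : ∀ z, u' z * v z = (-α)⁻¹ * (exp (-z) * z ^ (1 - α - 1) -
      z ^ (1 - α - 1) * (1 / (1 + z / n)) ^ ((n:ℝ) + 1)) := by
    intro z
    simp only [u', v]
    rw [show 1 - α - 1 = -α by ring]
    ring
  have huv' : IntegrableOn (u * v') (Ioi 0) :=
    integrableOn_inv_one_add_div_pow_sub_exp_neg_mul_rpow h0 h1 hn
  have hu'v : IntegrableOn (u' * v) (Ioi 0) := by
    refine ((hGi.sub hBi).const_mul (-α)⁻¹).congr (Eventually.of_forall fun z => ?_)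
    exact (hu'v_eq z).symm
  have hzero : Tendsto (u * v) (nhdsWithin 0 (Ioi 0)) (nhds 0) := by
    have hl : Tendsto (fun z : ℝ => z ^ (1 - α) / α) (nhdsWithin 0 (Ioi 0)) (nhds 0) := by
      have := ((continuousAt_rpow_const (0:ℝ) (1 - α) (Or.inr hα.le)).tendsto.div_const α)
      rw [zero_rpow hα.ne', zero_div] at this
      exact this.mono_left nhdsWithin_le_nhds
    refine squeeze_zero_norm' ?_ hl
    filter_upwards [self_mem_nhdsWithin] with z hz
    have hz : 0 < z := hz
    obtain ⟨b0, b1, -⟩ := inv_one_add_div_pow_sub_exp_neg_bounds hn hz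
    simp only [Pi.mul_apply, u, v]
    rw [div_neg, mul_neg, norm_neg, norm_of_nonneg (by positivity), ← mul_div_assoc,
      sub_eq_add_neg 1 α, rpow_one_add' hz.le (by linarith)]
    gcongr
  have hinf : Tendsto (u * v) atTop (nhds 0) := by
    have hl : Tendsto (fun z : ℝ => z ^ (-α) / α) atTop (nhds 0) := by
      simpa using (tendsto_rpow_neg_atTop h0).div_const α
    refine squeeze_zero_norm' ?_ hl
    filter_upwards [eventually_gt_atTop 0] with z hz
    obtain ⟨b0, -, b1⟩ := inv_one_add_div_pow_sub_exp_neg_bounds hn hz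
    simp only [Pi.mul_apply, u, v]
    rw [div_neg, mul_neg, norm_neg, norm_of_nonneg (by positivity)]
    exact mul_le_of_le_one_left (by positivity) b1
  have key := integral_Ioi_mul_deriv_eq_deriv_mul hu hv huv' hu'v hzero hinf
  have hR : ∫ z in Ioi (0:ℝ), u' z * v z = (-α)⁻¹ * (Real.Gamma (1 - α) -
      (n:ℝ) ^ (1 - α) * Real.Gamma (1 - α) * Real.Gamma (n + 1 - (1 - α)) /
        Real.Gamma (n + 1)) := by
    simp only [hu'v_eq]
    rw [integral_const_mul, integral_sub hGi hBi, ← hG, hB]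
  rw [key, hR, show (n:ℝ) + 1 - (1 - α) = n + α by ring, Real.Gamma_add_one hn'.ne',
    show 2 - α = (1 - α) + 1 by ring, Real.Gamma_add_one hα.ne', rpow_sub hn', rpow_one]
  have g1 := (Real.Gamma_pos_of_pos hα).ne'
  have g2 := (Real.Gamma_pos_of_pos hn').ne'
  have g3 := (rpow_pos_of_pos hn' α).ne'
  have g4 := hα.ne'
  field_simp
  ring
end

section
/- Let X be a complex Banach space, (T(t))_{t≥0} a bounded C₀-semigroup on X with M := sup_{t≥0} ‖T(t)‖. For each t > 0 let ν_t be a Borel probability measure on [0,∞) with ∫₀^∞ s dν_t(s) = 1 and σ_t² := ∫₀^∞ s² dν_t(s) < ∞, and for n ≥ 1 define the bounded operator P_{t,n} on X by P_{t,n} x = ∫₀^∞ T(ts/n) x dν_t(s) (Bochner integral). Suppose x, y, w ∈ X satisfy T(u)x = x − ∫₀ᵘ T(v)y dv and T(u)y = y − ∫₀ᵘ T(v)w dv for all u ≥ 0 (i.e. x ∈ dom(A²), y = Ax, w = A²x for the generator −A). Then for all t > 0 and all positive integers n: ‖ P_{t,n}ⁿ x − T(t) x ‖ ≤ M (σ_t²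 − 1) t² / (2n) · ‖w‖. -/
open MeasureTheory Real Set Filter

section Semigroup

variable {X : Type*} [NormedAddCommGroup X]

lemma intervalIntegrable_of_continuousOn_Ici {f : ℝ → X} (hf : ContinuousOn f (Set.Ici 0))
    {a b : ℝ} (ha : 0 ≤ a) (hb : 0 ≤ b) : IntervalIntegrable f volume a b :=
  (hf.mono fun _ hv => (le_min ha hb).trans hv.1).intervalIntegrable

variable [NormedSpace ℂ X]

lemma sub_eq_neg_integral_of_forall_eq_sub_integral {f g : ℝ → X} {x : X}
    (hg : ContinuousOn g (Set.Ici 0)) (h : ∀ u : ℝ, 0 ≤ u → f u = x - ∫ v in (0:ℝ)..u, g v)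
    {a b : ℝ} (ha : 0 ≤ a) (hb : 0 ≤ b) : f b - f a = -∫ v in a..b, g v := by
  rw [h a ha, h b hb, ← intervalIntegral.integral_interval_sub_left
    (intervalIntegrable_of_continuousOn_Ici hg le_rfl hb)
    (intervalIntegrable_of_continuousOn_Ici hg le_rfl ha)]
  abel

lemma norm_integral_le_mul_sq_div_two {f : ℝ → X} {C a b : ℝ}
    (h : ∀ v ∈ Set.uIcc a b, ‖f v‖ ≤ C * |v - a|) :
    ‖∫ v in a..b, f v‖ ≤ C * (b - a) ^ 2 / 2 := by
  have h_lin : ∫ v in a..b, C * (v - a) = C * (b - a) ^ 2 / 2 := by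
    rw [intervalIntegral.integral_const_mul,
      intervalIntegral.integral_comp_sub_right (fun v => v) a, integral_id]
    ring
  rcases le_total a b with hab | hab
  · rw [← h_lin]
    refine intervalIntegral.norm_integral_le_of_norm_le hab (.of_forall fun v hv => ?_)
      (Continuous.intervalIntegrable (by fun_prop) _ _)
    have := h v (Set.uIcc_of_le hab ▸ Set.Ioc_subset_Icc_self hv)
    rwa [abs_of_nonneg (sub_nonneg.2 hv.1.le)] at this
  · rw [intervalIntegral.integral_symm, norm_neg]
    have h_symm : ∫ v in b..a, C * (a - v) = C * (b - a) ^ 2 / 2 := by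
      rw [← h_lin, intervalIntegral.integral_symm, ← intervalIntegral.integral_neg]
      congr 1
      ext v
      ring
    rw [← h_symm]
    refine intervalIntegral.norm_integral_le_of_norm_le hab (.of_forall fun v hv => ?_)
      (Continuous.intervalIntegrable (by fun_prop) _ _)
    have := h v (Set.uIcc_of_ge hab ▸ Set.Ioc_subset_Icc_self hv)
    rwa [abs_of_nonpos (sub_nonpos.2 hv.2), neg_sub] at this

lemma norm_semigroup_taylor_le [CompleteSpace X] {T : ℝ → X →L[ℂ] X} {M : ℝ}
    (hTcont : ∀ x : X, ContinuousOn (fun t => T t x) (Set.Ici 0))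
    (hM : ∀ t : ℝ, 0 ≤ t → ‖T t‖ ≤ M) {x y w : X}
    (hx : ∀ u : ℝ, 0 ≤ u → T u x = x - ∫ v in (0:ℝ)..u, T v y)
    (hy : ∀ u : ℝ, 0 ≤ u → T u y = y - ∫ v in (0:ℝ)..u, T v w)
    {t r : ℝ} (ht : 0 ≤ t) (hr : 0 ≤ r) :
    ‖T r x - T t x + (r - t) • T t y‖ ≤ M * ‖w‖ * (r - t) ^ 2 / 2 := by
  have h_eq : T r x - T t x + (r - t) • T t y = -∫ v in t..r, (T v y - T t y) := by
    rw [intervalIntegral.integral_sub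
      (intervalIntegrable_of_continuousOn_Ici (hTcont y) ht hr) intervalIntegrable_const,
      intervalIntegral.integral_const,
      sub_eq_neg_integral_of_forall_eq_sub_integral (f := fun u => T u x) (hTcont y) hx ht hr]
    abel
  rw [h_eq, norm_neg]
  refine norm_integral_le_mul_sq_div_two fun v hv => ?_
  have hv0 : 0 ≤ v := (le_min ht hr).trans hv.1
  rw [sub_eq_neg_integral_of_forall_eq_sub_integral (f := fun u => T u y) (hTcont w) hy ht hv0,
    norm_neg]
  refine intervalIntegral.norm_integral_le_of_norm_le_const fun z hz => ?_
  exact (T z).le_of_opNorm_le (hM z ((le_min ht hv0).trans hz.1.le)) w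

lemma integrable_semigroup_apply {T : ℝ → X →L[ℂ] X} {M : ℝ}
    (hTcont : ∀ x : X, ContinuousOn (fun t => T t x) (Set.Ici 0))
    (hM : ∀ t : ℝ, 0 ≤ t → ‖T t‖ ≤ M) {c : ℝ} (hc : 0 ≤ c)
    {μ : Measure ℝ} [IsFiniteMeasure μ] (hμ : ∀ᵐ s ∂μ, 0 ≤ s) (v : X) :
    Integrable (fun s => T (c * s) v) μ := by
  have h_cont : Continuous fun s : ℝ => T (max (c * s) 0) v :=
    (hTcont v).comp_continuous (by fun_prop) fun s => Set.mem_Ici.2 (le_max_right _ _)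
  refine Integrable.of_bound (h_cont.aestronglyMeasurable.congr ?_) (M * ‖v‖) ?_
  · filter_upwards [hμ] with s hs
    rw [max_eq_left (mul_nonneg hc hs)]
  · filter_upwards [hμ] with s hs
    exact (T _).le_of_opNorm_le (hM _ (mul_nonneg hc hs)) v

lemma ae_nonneg_conv {μ ν : Measure ℝ} [IsProbabilityMeasure μ] [IsProbabilityMeasure ν]
    (hμ : ∀ᵐ s ∂μ, 0 ≤ s) (hν : ∀ᵐ s ∂ν, 0 ≤ s) : ∀ᵐ s ∂(μ.conv ν), 0 ≤ s := by
  rw [Measure.conv, ae_map_iff (by fun_prop) measurableSet_Ici]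
  filter_upwards [Measure.quasiMeasurePreserving_fst.ae hμ,
    Measure.quasiMeasurePreserving_snd.ae hν] with p h1 h2
  exact add_nonneg h1 h2

lemma integral_semigroup_conv [CompleteSpace X] {T : ℝ → X →L[ℂ] X} {M : ℝ}
    (hTadd : ∀ s t : ℝ, 0 ≤ s → 0 ≤ t → T (s + t) = (T s).comp (T t))
    (hTcont : ∀ x : X, ContinuousOn (fun t => T t x) (Set.Ici 0))
    (hM : ∀ t : ℝ, 0 ≤ t → ‖T t‖ ≤ M) {c : ℝ} (hc : 0 ≤ c)
    {μ ν : Measure ℝ} [IsProbabilityMeasure μ] [IsProbabilityMeasure ν]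
    (hμ : ∀ᵐ s ∂μ, 0 ≤ s) (hν : ∀ᵐ s ∂ν, 0 ≤ s) (v : X) :
    ∫ s, T (c * s) v ∂(μ.conv ν) = ∫ a, T (c * a) (∫ b, T (c * b) v ∂ν) ∂μ := by
  rw [integral_conv (integrable_semigroup_apply hTcont hM hc (ae_nonneg_conv hμ hν) v)]
  refine integral_congr_ae ?_
  filter_upwards [hμ] with a ha
  rw [← ContinuousLinearMap.integral_comp_comm _ (integrable_semigroup_apply hTcont hM hc hν v)]
  refine integral_congr_ae ?_
  filter_upwards [hν] with b hb
  rw [mul_add, hTadd _ _ (mul_nonneg hc ha) (mul_nonneg hc hb)]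
  rfl

end Semigroup

section Moments

variable {μ ν : Measure ℝ} [IsProbabilityMeasure μ] [IsProbabilityMeasure ν]

lemma integrable_id_conv (hμ : Integrable (fun s => s) μ) (hν : Integrable (fun s => s) ν) :
    Integrable (fun s => s) (μ.conv ν) := by
  rw [Measure.conv, integrable_map_measure (by fun_prop) (by fun_prop)]
  exact (hμ.comp_fst ν).add (hν.comp_snd μ)

lemma integral_id_conv (hμ : Integrable (fun s => s) μ) (hν : Integrable (fun s => s) ν) :
    ∫ s, s ∂(μ.conv ν) = ∫ s, s ∂μ + ∫ s, s ∂ν := by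
  rw [integral_conv (integrable_id_conv hμ hν)]
  have h (a : ℝ) : ∫ b, (a + b) ∂ν = a + ∫ s, s ∂ν := by
    rw [integral_add (integrable_const _) hν]
    simp
  simp_rw [h]
  rw [integral_add hμ (integrable_const _)]
  simp

lemma integrable_sq_conv (hμ : Integrable (fun s => s) μ) (hν : Integrable (fun s => s) ν)
    (hμ2 : Integrable (fun s => s ^ 2) μ) (hν2 : Integrable (fun s => s ^ 2) ν) :
    Integrable (fun s => s ^ 2) (μ.conv ν) := by
  rw [Measure.conv, integrable_map_measure (by fun_prop) (by fun_prop)]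
  refine (((hμ2.comp_fst ν).add ((hμ.mul_prod hν).const_mul 2)).add
    (hν2.comp_snd μ)).congr (.of_forall fun p => ?_)
  simp only [Pi.add_apply, Function.comp_apply]
  ring

lemma integral_sq_conv (hμ : Integrable (fun s => s) μ) (hν : Integrable (fun s => s) ν)
    (hμ2 : Integrable (fun s => s ^ 2) μ) (hν2 : Integrable (fun s => s ^ 2) ν) :
    ∫ s, s ^ 2 ∂(μ.conv ν)
      = ∫ s, s ^ 2 ∂μ + 2 * (∫ s, s ∂μ) * (∫ s, s ∂ν) + ∫ s, s ^ 2 ∂ν := by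
  rw [integral_conv (integrable_sq_conv hμ hν hμ2 hν2)]
  have h (a : ℝ) : ∫ b, (a + b) ^ 2 ∂ν
      = a ^ 2 + a * (2 * ∫ s, s ∂ν) + ∫ s, s ^ 2 ∂ν := by
    have h_expand (b : ℝ) : (a + b) ^ 2 = a ^ 2 + 2 * a * b + b ^ 2 := by ring
    simp_rw [h_expand]
    rw [integral_add ((integrable_const _).fun_add (hν.const_mul _)) hν2,
      integral_add (integrable_const _) (hν.const_mul _), integral_const_mul]
    simp
    ring
  simp_rw [h]
  rw [integral_add (hμ2.fun_add (hμ.mul_const _)) (integrable_const _),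
    integral_add hμ2 (hμ.mul_const _), integral_mul_const]
  simp
  ring

end Moments

lemma exists_measure_iterate_eq_integral
    {X : Type*} [NormedAddCommGroup X] [NormedSpace ℂ X] [CompleteSpace X]
    {T : ℝ → X →L[ℂ] X} {M : ℝ} (hT0 : T 0 = 1)
    (hTadd : ∀ s t : ℝ, 0 ≤ s → 0 ≤ t → T (s + t) = (T s).comp (T t))
    (hTcont : ∀ x : X, ContinuousOn (fun t => T t x) (Set.Ici 0))
    (hM : ∀ t : ℝ, 0 ≤ t → ‖T t‖ ≤ M) {c : ℝ} (hc : 0 ≤ c)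
    {ν : Measure ℝ} [IsProbabilityMeasure ν] (hν : ∀ᵐ s ∂ν, 0 ≤ s)
    (hν1 : Integrable (fun s => s) ν) (hmean : ∫ s, s ∂ν = 1)
    (hν2 : Integrable (fun s => s ^ 2) ν) (n : ℕ) :
    ∃ μ : Measure ℝ, IsProbabilityMeasure μ ∧ (∀ᵐ s ∂μ, 0 ≤ s) ∧
      Integrable (fun s => s) μ ∧ Integrable (fun s => s ^ 2) μ ∧ ∫ s, s ∂μ = n ∧
      ∫ s, s ^ 2 ∂μ = n * ((∫ s, s ^ 2 ∂ν) - 1) + n ^ 2 ∧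
      ∀ v : X, (fun v : X => ∫ s, T (c * s) v ∂ν)^[n] v = ∫ s, T (c * s) v ∂μ := by
  induction n with
  | zero =>
    refine ⟨Measure.dirac 0, inferInstance, ?_, ?_, ?_, ?_, ?_, fun v => ?_⟩
    · simp [ae_dirac_eq]
    · exact integrable_dirac (by simp)
    · exact integrable_dirac (by simp)
    · simp
    · simp
    · simp [hT0]
  | succ k ih =>
    obtain ⟨μ, _, hμ, hμ1, hμ2, h_mean, h_sq, h_iter⟩ := ih
    refine ⟨ν.conv μ, inferInstance, ae_nonneg_conv hν hμ, integrable_id_conv hν1 hμ1,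
      integrable_sq_conv hν1 hμ1 hν2 hμ2, ?_, ?_, fun v => ?_⟩
    · rw [integral_id_conv hν1 hμ1, hmean, h_mean]
      push_cast
      ring
    · rw [integral_sq_conv hν1 hμ1 hν2 hμ2, hmean, h_mean, h_sq]
      push_cast
      ring
    · rw [Function.iterate_succ_apply', h_iter,
        integral_semigroup_conv hTadd hTcont hM hc hν hμ]



theorem stmt_16
    {X : Type*} [NormedAddCommGroup X] [NormedSpace ℂ X] [CompleteSpace X]
    (T : ℝ → X →L[ℂ] X) (M : ℝ)
    (hT0 : T 0 = 1)
    (hTadd : ∀ s t : ℝ, 0 ≤ s → 0 ≤ t → T (s + t) = (T s).comp (T t))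
    (hTcont : ∀ x : X, ContinuousOn (fun t => T t x) (Set.Ici 0))
    (hM : ∀ t : ℝ, 0 ≤ t → ‖T t‖ ≤ M)
    (ν : ℝ → Measure ℝ)
    (hprob : ∀ t : ℝ, 0 < t → IsProbabilityMeasure (ν t))
    (hsupp : ∀ t : ℝ, 0 < t → (ν t) (Set.Iio 0) = 0)
    (hint1 : ∀ t : ℝ, 0 < t → Integrable (fun s => s) (ν t))
    (hmean : ∀ t : ℝ, 0 < t → (∫ s, s ∂(ν t)) = 1)
    (hint2 : ∀ t : ℝ, 0 < t → Integrable (fun s => s ^ 2) (ν t))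
    (x y w : X)
    (hx : ∀ u : ℝ, 0 ≤ u → T u x = x - ∫ v in (0:ℝ)..u, T v y)
    (hy : ∀ u : ℝ, 0 ≤ u → T u y = y - ∫ v in (0:ℝ)..u, T v w) :
    ∀ t : ℝ, 0 < t → ∀ n : ℕ, 0 < n →
      ‖(fun v : X => ∫ s, T (t * s / n) v ∂(ν t))^[n] x - T t x‖
        ≤ M * ((∫ s, s ^ 2 ∂(ν t)) - 1) * t ^ 2 / (2 * n) * ‖w‖ := by
  intro t ht n hn
  have := hprob t ht
  have hn0 : (0 : ℝ) < n := Nat.cast_pos.2 hn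
  have hν : ∀ᵐ s ∂(ν t), 0 ≤ s := by
    simpa [ae_iff, Set.Iio_def] using hsupp t ht
  have hc : 0 ≤ t / n := by positivity
  obtain ⟨μ, _, hμ, hμ1, hμ2, h_mean, h_sq, h_iter⟩ := exists_measure_iterate_eq_integral
    hT0 hTadd hTcont hM hc hν (hint1 t ht) (hmean t ht) (hint2 t ht) n
  have h_op : (fun v : X => ∫ s, T (t * s / n) v ∂(ν t))
      = fun v : X => ∫ s, T (t / n * s) v ∂(ν t) := by
    simp_rw [div_mul_eq_mul_div]
  have hTx := integrable_semigroup_apply hTcont hM hc hμ x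
  have h_lin : Integrable (fun s : ℝ => t / n * s - t) μ :=
    (hμ1.const_mul _).sub (integrable_const _)
  have h_lin_zero : ∫ s, (t / n * s - t) ∂μ = 0 := by
    rw [integral_sub (hμ1.const_mul _) (integrable_const _), integral_const_mul, h_mean]
    simp [hn0.ne']
  have h_eq : (∫ s, T (t / n * s) x ∂μ) - T t x
      = ∫ s, (T (t / n * s) x - T t x + (t / n * s - t) • T t y) ∂μ := by
    rw [integral_add (hTx.sub' (integrable_const _)) (h_lin.smul_const _),
      integral_sub hTx (integrable_const _), integral_smul_const, h_lin_zero]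
    simp
  have h_expand (s : ℝ) : M * ‖w‖ * (t / n * s - t) ^ 2 / 2
      = M * ‖w‖ * (t / n) ^ 2 / 2 * s ^ 2 - M * ‖w‖ * (t / n) * t * s
        + M * ‖w‖ * t ^ 2 / 2 := by ring
  have h_int := (hμ2.const_mul (M * ‖w‖ * (t / n) ^ 2 / 2)).sub'
    (hμ1.const_mul (M * ‖w‖ * (t / n) * t))
  have h_bound : ∫ s, M * ‖w‖ * (t / n * s - t) ^ 2 / 2 ∂μ
      = M * ((∫ s, s ^ 2 ∂(ν t)) - 1) * t ^ 2 / (2 * n) * ‖w‖ := by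
    simp_rw [h_expand]
    rw [integral_add h_int (integrable_const _),
      integral_sub (hμ2.const_mul _) (hμ1.const_mul _), integral_const_mul, integral_const_mul,
      h_mean, h_sq]
    simp
    field_simp
    ring
  rw [h_op, h_iter, h_eq, ← h_bound]
  refine norm_integral_le_of_norm_le ?_ ?_
  · simp_rw [h_expand]
    exact h_int.add (integrable_const _)
  · filter_upwards [hμ] with s hs
    exact norm_semigroup_taylor_le hTcont hM hx hy ht.le (mul_nonneg hc hs)
end
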